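/- Let c₀ > 1. There exist ν₀ ∈ (0,1], c > 0 and C > 1, depending only on c₀, with the following property: for every ν with 0 < ν < ν₀, every real α with |α| ≥ c₀, and every rapidly decaying solution θ of the critical QG mode system with viscosity ν at wave number α, one has Σ_β |θ(t,β)|² ≤ C² e^{−2c ν^{3/5} t} Σ_β |θ(0,β)|² for all 0 ≤ t ≤ C^{−1} ν^{−1}. -/

import Mathlib

/-- `S(β) = (α² + β²)^{1/2}`. -/
noncomputable def Sv (α : ℝ) (β : ℤ) : ℝ := Real.sqrt (α ^ 2 + (β : ℝ) ^ 2)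

/-- A family `θ : ℝ → ℤ → ℂ` is rapidly decaying if for every `k ∈ ℕ` and `T > 0`,
`sup_{0 ≤ t ≤ T} Σ_β (1+β²)^k |θ(t,β)|² < ∞`. -/
def RapidlyDecaying (θ : ℝ → ℤ → ℂ) : Prop :=
  ∀ k : ℕ, ∀ T : ℝ, 0 < T → ∃ M : ℝ, ∀ t : ℝ, 0 ≤ t → t ≤ T →
    Summable (fun β : ℤ => (1 + (β : ℝ) ^ 2) ^ k * ‖θ t β‖ ^ 2) ∧
    (∑' β : ℤ, (1 + (β : ℝ) ^ 2) ^ k * ‖θ t β‖ ^ 2) ≤ M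

/-- The critical QG mode system with viscosity `ν` at wave number `α`:
`d/dt θ(t,β) = −ν S(β) θ(t,β) − (i α e^{−νt}/2)[(1 − S(β−1)⁻¹) θ(t,β−1) + (1 − S(β+1)⁻¹) θ(t,β+1)]`. -/
def CriticalQG (α ν : ℝ) (θ : ℝ → ℤ → ℂ) : Prop :=
  ∀ t : ℝ, ∀ β : ℤ,
    HasDerivAt (fun s => θ s β)
      (-((ν * Sv α β : ℝ) : ℂ) * θ t β
        - Complex.I * (α : ℂ) * ((Real.exp (-(ν * t)) : ℝ) : ℂ) / 2 *
          ((1 - ((Sv α (β - 1) : ℝ) : ℂ)⁻¹) * θ t (β - 1)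
            + (1 - ((Sv α (β + 1) : ℝ) : ℂ)⁻¹) * θ t (β + 1))) t


/-- Rapidly decaying real sequences. -/
def RD (v : ℤ → ℝ) : Prop := ∀ k : ℕ, ∃ C : ℝ, ∀ β : ℤ, (1 + (β : ℝ) ^ 2) ^ k * |v β| ≤ C

/-- Polynomially bounded sequences. -/
def PB (c : ℤ → ℝ) : Prop := ∃ k : ℕ, ∃ C : ℝ, ∀ β : ℤ, |c β| ≤ C * (1 + (β : ℝ) ^ 2) ^ k

lemma one_le_wt (β : ℤ) (k : ℕ) : (1 : ℝ) ≤ (1 + (β : ℝ) ^ 2) ^ k :=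
  one_le_pow₀ (by nlinarith [sq_nonneg (β : ℝ)])

lemma PB.mul {c d : ℤ → ℝ} (hc : PB c) (hd : PB d) : PB (fun β => c β * d β) := by
  obtain ⟨k, C, h⟩ := hc
  obtain ⟨l, D, h'⟩ := hd
  refine ⟨k + l, C * D, fun β => ?_⟩
  have h1 := h β
  have h2 := h' β
  rw [abs_mul, pow_add]
  calc |c β| * |d β| ≤ (C * (1 + (β : ℝ) ^ 2) ^ k) * (D * (1 + (β : ℝ) ^ 2) ^ l) :=
        mul_le_mul h1 h2 (abs_nonneg _) ((abs_nonneg _).trans h1)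
    _ = _ := by ring

lemma PB.of_bdd {c : ℤ → ℝ} (C : ℝ) (h : ∀ β, |c β| ≤ C) : PB c :=
  ⟨0, C, fun β => by simpa using h β⟩

lemma PB.const (C : ℝ) : PB (fun _ => C) := PB.of_bdd |C| (fun _ => le_rfl)

lemma PB.add {c d : ℤ → ℝ} (hc : PB c) (hd : PB d) : PB (fun β => c β + d β) := by
  obtain ⟨k, C, h⟩ := hc
  obtain ⟨l, D, h'⟩ := hd
  refine ⟨k + l, |C| + |D|, fun β => ?_⟩
  have h1 := h β
  have h2 := h' β
  have e1 := one_le_wt β k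
  have e2 := one_le_wt β l
  rw [pow_add]
  set x := (1 + (β : ℝ) ^ 2) ^ k
  set y := (1 + (β : ℝ) ^ 2) ^ l
  have a1 : C * x ≤ |C| * (x * y) := by
    have : C * x ≤ |C| * x := mul_le_mul_of_nonneg_right (le_abs_self C) (by linarith)
    have : |C| * x ≤ |C| * (x * y) :=
      mul_le_mul_of_nonneg_left (by nlinarith) (abs_nonneg _)
    linarith
  have a2 : D * y ≤ |D| * (x * y) := by
    have : D * y ≤ |D| * y := mul_le_mul_of_nonneg_right (le_abs_self D) (by linarith)
    have : |D| * y ≤ |D| * (x * y) :=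
      mul_le_mul_of_nonneg_left (by nlinarith) (abs_nonneg _)
    linarith
  calc |c β + d β| ≤ |c β| + |d β| := abs_add_le _ _
    _ ≤ (|C| + |D|) * (x * y) := by linarith

lemma PB.neg {c : ℤ → ℝ} (hc : PB c) : PB (fun β => - c β) := by
  obtain ⟨k, C, h⟩ := hc
  exact ⟨k, C, fun β => by simpa using h β⟩

lemma PB.sub {c d : ℤ → ℝ} (hc : PB c) (hd : PB d) : PB (fun β => c β - d β) := by
  simpa [sub_eq_add_neg] using hc.add hd.neg

lemma wt_shift (β j : ℤ) (k : ℕ) :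
    (1 + (β : ℝ) ^ 2) ^ k ≤ (2 * (1 + (j : ℝ) ^ 2)) ^ k * (1 + ((β + j : ℤ) : ℝ) ^ 2) ^ k := by
  rw [← mul_pow]
  apply pow_le_pow_left₀ (by positivity)
  push_cast
  nlinarith [sq_nonneg ((β : ℝ) + 2 * j), sq_nonneg ((j : ℝ) * (β + j)), sq_nonneg (β : ℝ), sq_nonneg (j : ℝ)]

lemma PB.shift {c : ℤ → ℝ} (hc : PB c) (j : ℤ) : PB (fun β => c (β + j)) := by
  obtain ⟨k, C, h⟩ := hc
  refine ⟨k, |C| * (2 * (1 + (j : ℝ) ^ 2)) ^ k, fun β => (h (β + j)).trans ?_⟩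
  have := wt_shift (β + j) (-j) k
  simp only [neg_add_cancel_right, add_neg_cancel_right] at this
  have h2 : (1 + (((-j : ℤ)) : ℝ) ^ 2) = 1 + (j : ℝ) ^ 2 := by push_cast; ring
  rw [h2] at this
  calc C * (1 + ((β + j : ℤ) : ℝ) ^ 2) ^ k ≤ |C| * (1 + ((β + j : ℤ) : ℝ) ^ 2) ^ k :=
        mul_le_mul_of_nonneg_right (le_abs_self C) (by positivity)
    _ ≤ |C| * ((2 * (1 + (j : ℝ) ^ 2)) ^ k * (1 + (β : ℝ) ^ 2) ^ k) :=
        mul_le_mul_of_nonneg_left this (abs_nonneg _)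
    _ = _ := by ring

lemma RD.pb {v : ℤ → ℝ} (hv : RD v) : PB v := by
  obtain ⟨C, h⟩ := hv 0
  exact PB.of_bdd C (fun β => by simpa using h β)

lemma PB.mul_rd {c v : ℤ → ℝ} (hc : PB c) (hv : RD v) : RD (fun β => c β * v β) := by
  intro k
  obtain ⟨l, C, h⟩ := hc
  obtain ⟨D, h'⟩ := hv (k + l)
  refine ⟨|C| * D, fun β => ?_⟩
  have h1 := h β
  have h2 := h' β
  rw [pow_add] at h2
  rw [abs_mul]
  have e1 := one_le_wt β k
  have e2 := one_le_wt β l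
  set x := (1 + (β : ℝ) ^ 2) ^ k
  set y := (1 + (β : ℝ) ^ 2) ^ l
  have a1 : |c β| ≤ |C| * y := h1.trans (mul_le_mul_of_nonneg_right (le_abs_self C) (by linarith))
  calc x * (|c β| * |v β|) = |c β| * (x * |v β|) := by ring
    _ ≤ (|C| * y) * (x * |v β|) := mul_le_mul_of_nonneg_right a1 (by positivity)
    _ = |C| * (x * y * |v β|) := by ring
    _ ≤ |C| * D := mul_le_mul_of_nonneg_left h2 (abs_nonneg _)

lemma RD.mul {u v : ℤ → ℝ} (hu : RD u) (hv : RD v) : RD (fun β => u β * v β) := hu.pb.mul_rd hv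

lemma RD.mul_pb {c v : ℤ → ℝ} (hv : RD v) (hc : PB c) : RD (fun β => v β * c β) := by
  simpa [mul_comm] using hc.mul_rd hv

lemma RD.add {u v : ℤ → ℝ} (hu : RD u) (hv : RD v) : RD (fun β => u β + v β) := by
  intro k
  obtain ⟨C, h⟩ := hu k
  obtain ⟨D, h'⟩ := hv k
  refine ⟨C + D, fun β => ?_⟩
  have := mul_le_mul_of_nonneg_left (abs_add_le (u β) (v β))
    (zero_le_one.trans (one_le_wt β k))
  linarith [h β, h' β]

lemma RD.neg {u : ℤ → ℝ} (hu : RD u) : RD (fun β => - u β) := by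
  intro k
  obtain ⟨C, h⟩ := hu k
  exact ⟨C, fun β => by simpa using h β⟩

lemma RD.sub {u v : ℤ → ℝ} (hu : RD u) (hv : RD v) : RD (fun β => u β - v β) := by
  simpa [sub_eq_add_neg] using hu.add hv.neg

lemma RD.abs {u : ℤ → ℝ} (hu : RD u) : RD (fun β => |u β|) := by
  intro k
  obtain ⟨C, h⟩ := hu k
  exact ⟨C, fun β => by simpa using h β⟩

lemma RD.const_mul {u : ℤ → ℝ} (hu : RD u) (c : ℝ) : RD (fun β => c * u β) :=
  (PB.const c).mul_rd hu

lemma RD.pow {u : ℤ → ℝ} (hu : RD u) : RD (fun β => u β ^ 2) := by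
  simpa [sq] using hu.mul hu

lemma RD.shift {v : ℤ → ℝ} (hv : RD v) (j : ℤ) : RD (fun β => v (β + j)) := by
  intro k
  obtain ⟨C, h⟩ := hv k
  refine ⟨(2 * (1 + (j : ℝ) ^ 2)) ^ k * C, fun β => ?_⟩
  have h1 := wt_shift β j k
  calc (1 + (β : ℝ) ^ 2) ^ k * |v (β + j)|
      ≤ ((2 * (1 + (j : ℝ) ^ 2)) ^ k * (1 + ((β + j : ℤ) : ℝ) ^ 2) ^ k) * |v (β + j)| :=
        mul_le_mul_of_nonneg_right h1 (abs_nonneg _)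
    _ = (2 * (1 + (j : ℝ) ^ 2)) ^ k * ((1 + ((β + j : ℤ) : ℝ) ^ 2) ^ k * |v (β + j)|) := by ring
    _ ≤ _ := mul_le_mul_of_nonneg_left (h _) (by positivity)

lemma RD.shiftm {v : ℤ → ℝ} (hv : RD v) (j : ℤ) : RD (fun β => v (β - j)) := by
  simpa [sub_eq_add_neg] using hv.shift (-j)

lemma PB.shiftm {v : ℤ → ℝ} (hv : PB v) (j : ℤ) : PB (fun β => v (β - j)) := by
  simpa [sub_eq_add_neg] using hv.shift (-j)

lemma summable_wt : Summable (fun β : ℤ => (1 : ℝ) / (1 + (β : ℝ) ^ 2)) := by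
  have h : Summable (fun β : ℤ => (1 : ℝ) / (β : ℝ) ^ 2) :=
    Real.summable_one_div_int_pow.mpr (by norm_num)
  have h0 : Summable (fun β : ℤ => if β = 0 then (1 : ℝ) else 0) :=
    summable_of_hasFiniteSupport (by
      apply Set.Finite.subset (Set.finite_singleton (0 : ℤ))
      intro x hx
      by_contra hne
      simp at hx hne
      exact hne hx)
  refine Summable.of_nonneg_of_le (fun β => by positivity) (fun β => ?_) (h.add h0)
  by_cases hb : β = 0
  · subst hb; simp
  · have : (β : ℝ) ≠ 0 := by exact_mod_cast hb
    simp only [hb, if_false, add_zero]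
    apply one_div_le_one_div_of_le (by positivity)
    linarith

lemma RD.summable {v : ℤ → ℝ} (hv : RD v) : Summable v := by
  obtain ⟨C, h⟩ := hv 1
  refine Summable.of_norm_bounded (summable_wt.mul_left C) (fun β => ?_)
  have := h β
  rw [pow_one] at this
  rw [Real.norm_eq_abs, mul_one_div, le_div_iff₀ (by positivity)]
  linarith

lemma tsum_shift (g : ℤ → ℝ) (j : ℤ) : ∑' β, g (β + j) = ∑' β, g β :=
  (Equiv.addRight j).tsum_eq g

lemma tsum_le_tel {F G U : ℤ → ℝ} (hF : RD F) (hG : RD G) (hU : RD U)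
    (h : ∀ β, F β ≤ G β + (U (β + 1) - U β)) : ∑' β, F β ≤ ∑' β, G β := by
  have h1 : ∑' β, (G β + (U (β + 1) - U β)) = ∑' β, G β := by
    rw [(hG.summable).tsum_add ((hU.shift 1).sub hU).summable,
      ((hU.shift 1).summable).tsum_sub hU.summable, tsum_shift]
    simp
  rw [← h1]
  exact hF.summable.tsum_le_tsum h (hG.add ((hU.shift 1).sub hU)).summable

lemma tsum_eq_tel {F G U : ℤ → ℝ} (hF : RD F) (hG : RD G) (hU : RD U)
    (h : ∀ β, F β = G β + (U (β + 1) - U β)) : ∑' β, F β = ∑' β, G β := by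
  apply le_antisymm (tsum_le_tel hF hG hU (fun β => (h β).le))
  apply tsum_le_tel hG hF hU.neg (fun β => ?_)
  rw [h β]; linarith

/-! Facts on `S` -/

lemma Sv_sq (α : ℝ) (β : ℤ) : Sv α β ^ 2 = α ^ 2 + (β : ℝ) ^ 2 :=
  Real.sq_sqrt (by positivity)

lemma Sv_nonneg (α : ℝ) (β : ℤ) : 0 ≤ Sv α β := Real.sqrt_nonneg _

lemma le_Sv {α : ℝ} (hα : 0 ≤ α) (β : ℤ) : α ≤ Sv α β :=
  Real.le_sqrt_of_sq_le (by nlinarith [sq_nonneg (β : ℝ)])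

lemma abs_le_Sv (α : ℝ) (β : ℤ) : |(β : ℝ)| ≤ Sv α β := by
  apply Real.le_sqrt_of_sq_le
  rw [sq_abs]; nlinarith [sq_nonneg α]

lemma Sv_succ_le (α : ℝ) (β : ℤ) : Sv α (β + 1) ≤ Sv α β + 1 := by
  have h := Sv_sq α β
  have h2 := abs_le_Sv α β
  have h3 := le_abs_self (β : ℝ)
  apply Real.sqrt_le_iff.mpr ⟨by linarith [Sv_nonneg α β], ?_⟩
  push_cast; nlinarith

lemma Sv_pred_le (α : ℝ) (β : ℤ) : Sv α (β - 1) ≤ Sv α β + 1 := by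
  have h := Sv_sq α β
  have h2 := abs_le_Sv α β
  have h3 := neg_abs_le (β : ℝ)
  apply Real.sqrt_le_iff.mpr ⟨by linarith [Sv_nonneg α β], ?_⟩
  push_cast; nlinarith

lemma Sv_conv {α : ℝ} (hα : 1 ≤ α) (β : ℤ) : 2 * Sv α β ≤ Sv α (β - 1) + Sv α (β + 1) := by
  have h := Sv_sq α β
  have h1 := Sv_sq α (β + 1)
  have h2 := Sv_sq α (β - 1)
  have n := Sv_nonneg α β
  have n1 := Sv_nonneg α (β + 1)
  have n2 := Sv_nonneg α (β - 1)
  push_cast at h1 h2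
  set x := Sv α (β - 1)
  set y := Sv α (β + 1)
  set s := Sv α β
  -- (xy)^2 >= (s^2-1)^2
  have hxy : s ^ 2 - 1 ≤ x * y := by
    refine (le_abs_self _).trans (abs_le_of_sq_le_sq ?_ (by positivity))
    have e : (x * y) ^ 2 = (α ^ 2 + ((β : ℝ) - 1) ^ 2) * (α ^ 2 + ((β : ℝ) + 1) ^ 2) := by
      rw [mul_pow, h1, h2]
    rw [e, h]
    nlinarith [sq_nonneg α]
  refine (le_abs_self _).trans (abs_le_of_sq_le_sq ?_ (by positivity))
  nlinarith

lemma Sv_two {α : ℝ} (hα : 1 ≤ α) (β : ℤ) :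
    Sv α (β - 2) + Sv α (β + 2) ≤ 2 * Sv α β + 4 := by
  have a := Sv_succ_le α β
  have b := Sv_succ_le α (β + 1)
  have c := Sv_pred_le α β
  have d := Sv_pred_le α (β - 1)
  rw [add_assoc] at b
  rw [sub_sub] at d
  norm_num at b d
  linarith


noncomputable def Av (α : ℝ) (β : ℤ) : ℝ := 1 - (Sv α β)⁻¹
noncomputable def Cm (v : ℤ → ℝ) (β : ℤ) : ℝ := (v (β - 1) - v (β + 1)) / 2
noncomputable def Pm (v : ℤ → ℝ) (β : ℤ) : ℝ := (v (β - 1) + v (β + 1)) / 2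

lemma Sv_ge {c₀ α : ℝ} (hc : 1 < c₀) (hα : c₀ ≤ α) (β : ℤ) : c₀ ≤ Sv α β :=
  hα.trans (le_Sv (by linarith) β)

lemma Av_le {c₀ α : ℝ} (hc : 1 < c₀) (hα : c₀ ≤ α) (β : ℤ) : Av α β ≤ 1 := by
  have := Sv_ge hc hα β
  have : 0 < (Sv α β)⁻¹ := inv_pos.mpr (by linarith)
  unfold Av; linarith

lemma Av_ge {c₀ α : ℝ} (hc : 1 < c₀) (hα : c₀ ≤ α) (β : ℤ) : 1 - c₀⁻¹ ≤ Av α β := by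
  have h := Sv_ge hc hα β
  have : (Sv α β)⁻¹ ≤ c₀⁻¹ := inv_anti₀ (by linarith) h
  unfold Av; linarith

lemma kap_pos {c₀ : ℝ} (hc : 1 < c₀) : 0 < 1 - c₀⁻¹ := by
  have := inv_lt_one_of_one_lt₀ hc
  linarith

lemma kap_lt {c₀ : ℝ} (hc : 1 < c₀) : 1 - c₀⁻¹ < 1 := by
  have : 0 < c₀⁻¹ := inv_pos.mpr (by linarith)
  linarith

lemma Av_pos {c₀ α : ℝ} (hc : 1 < c₀) (hα : c₀ ≤ α) (β : ℤ) : 0 < Av α β :=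
  (kap_pos hc).trans_le (Av_ge hc hα β)

lemma PB_S (α : ℝ) : PB (Sv α) := by
  refine ⟨1, 1 + α ^ 2, fun β => ?_⟩
  rw [abs_of_nonneg (Sv_nonneg α β), pow_one]
  apply Real.sqrt_le_iff.mpr ⟨by positivity, ?_⟩
  nlinarith [sq_nonneg (β : ℝ), sq_nonneg α, sq_nonneg ((β : ℝ) * α), sq_nonneg ((β : ℝ) * α ^ 2),
    sq_nonneg ((β : ℝ) ^ 2), sq_nonneg (α ^ 2), sq_nonneg ((β : ℝ) ^ 2 * α), sq_nonneg ((β : ℝ) ^ 2 * α ^ 2)]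

lemma PB_A {c₀ α : ℝ} (hc : 1 < c₀) (hα : c₀ ≤ α) : PB (Av α) :=
  PB.of_bdd 1 (fun β => by
    rw [abs_of_pos (Av_pos hc hα β)]; exact Av_le hc hα β)

lemma PB_Ainv {c₀ α : ℝ} (hc : 1 < c₀) (hα : c₀ ≤ α) : PB (fun β => (Av α β)⁻¹) :=
  PB.of_bdd (1 - c₀⁻¹)⁻¹ (fun β => by
    rw [abs_of_pos (inv_pos.mpr (Av_pos hc hα β))]
    exact inv_anti₀ (kap_pos hc) (Av_ge hc hα β))

lemma PB_Sinv {c₀ α : ℝ} (hc : 1 < c₀) (hα : c₀ ≤ α) : PB (fun β => (Sv α β)⁻¹) :=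
  PB.of_bdd 1 (fun β => by
    have := Sv_ge hc hα β
    rw [abs_of_pos (inv_pos.mpr (by linarith))]
    exact inv_le_one_of_one_le₀ (by linarith))

lemma RD.Cm {v : ℤ → ℝ} (hv : RD v) : RD (Cm v) := by
  have := ((hv.shiftm 1).sub (hv.shift 1)).const_mul (1 / 2)
  unfold _root_.Cm
  convert this using 2
  ring

lemma RD.Pm {v : ℤ → ℝ} (hv : RD v) : RD (Pm v) := by
  have := ((hv.shiftm 1).add (hv.shift 1)).const_mul (1 / 2)
  unfold _root_.Pm
  convert this using 2
  ring

/-- the right-hand side for `v = A ψ`. -/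
noncomputable def dv (α ν a : ℝ) (v : ℤ → ℝ) (β : ℤ) : ℝ :=
  -ν * (Sv α β * v β) + a * (Av α β * Cm v β)

lemma RD.dv {c₀ α : ℝ} (hc : 1 < c₀) (hα : c₀ ≤ α) (ν a : ℝ) {v : ℤ → ℝ} (hv : RD v) :
    RD (dv α ν a v) :=
  (((PB_S α).mul_rd hv).const_mul _).add (((PB_A hc hα).mul_rd hv.Cm).const_mul a)

lemma sum_xCx {x : ℤ → ℝ} (hx : RD x) : ∑' β, x β * Cm x β = 0 := by
  have h : ∑' β, x β * Cm x β = ∑' β : ℤ, (0 : ℝ) := by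
    apply tsum_eq_tel (U := fun β => -(x (β - 1) * x β) * (1 / 2)) (hx.mul hx.Cm)
    · intro k; exact ⟨0, fun β => by simp⟩
    · exact (((hx.shiftm 1).mul hx).neg).mul_pb (PB.const _)
    · intro β; simp only [Cm, add_sub_cancel_right]; ring
  rw [h, tsum_zero]

lemma sum_e {c₀ α : ℝ} (hc : 1 < c₀) (hα : c₀ ≤ α) (ν a : ℝ) {v : ℤ → ℝ} (hv : RD v) :
    ∑' β, 2 * (v β * dv α ν a v β) * (Av α β)⁻¹ = -2 * ν * ∑' β, Sv α β * v β ^ 2 * (Av α β)⁻¹ := by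
  have h1 : RD (fun β => Sv α β * v β ^ 2 * (Av α β)⁻¹) :=
    ((PB_S α).mul_rd hv.pow).mul_pb (PB_Ainv hc hα)
  have h2 : RD (fun β => v β * Cm v β) := hv.mul hv.Cm
  have : ∀ β, 2 * (v β * dv α ν a v β) * (Av α β)⁻¹ =
      -2 * ν * (Sv α β * v β ^ 2 * (Av α β)⁻¹) + 2 * a * (v β * Cm v β) := by
    intro β
    have := (Av_pos hc hα β).ne'
    unfold dv; field_simp
  simp_rw [this]
  rw [(h1.const_mul _).summable.tsum_add (h2.const_mul _).summable, tsum_mul_left, tsum_mul_left,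
    sum_xCx hv]
  ring

lemma Cm_dv (α ν a : ℝ) (v : ℤ → ℝ) (β : ℤ) : Cm (dv α ν a v) β =
    -ν * Cm (fun b => Sv α b * v b) β + a * Cm (fun b => Av α b * Cm v b) β := by
  simp only [Cm, dv]; ring

lemma Sv_div {c₀ α : ℝ} (hc : 1 < c₀) (hα : c₀ ≤ α) (β : ℤ) :
    Sv α β + 1 ≤ Sv α β * (Av α β)⁻¹ := by
  have h := Sv_ge hc hα β
  have hp := Av_pos hc hα β
  rw [← div_eq_mul_inv, le_div_iff₀ hp]
  unfold Av
  have hs : Sv α β * (Sv α β)⁻¹ = 1 := mul_inv_cancel₀ (by linarith)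
  have : 0 < (Sv α β)⁻¹ := inv_pos.mpr (by linarith)
  nlinarith

lemma sum_h_core {c₀ α : ℝ} (hc : 1 < c₀) (hα : c₀ ≤ α) {v : ℤ → ℝ} (hv : RD v) :
    ∑' β, (Av α β * Sv α β * Pm v β ^ 2 + 1 / 2 * v β ^ 2) ≤
      ∑' β, (Sv α β * v β ^ 2 * (Av α β)⁻¹ - Av α β * Cm v β * Cm (fun b => Sv α b * v b) β) := by
  have hS := PB_S α
  have hA := PB_A hc hα
  have hSv : RD (fun b => Sv α b * v b) := hS.mul_rd hv
  apply tsum_le_tel (U := fun β => -(Av α β * (1 / 4 * Sv α (β - 1) + 1 / 8 * (Sv α (β - 1) + Sv α (β + 1))) * v (β - 1) ^ 2)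
      + (Av α (β - 1) * (1 / 4 * Sv α β + 1 / 8 * (Sv α (β - 2) + Sv α β)) * v β ^ 2))
  · exact ((hA.mul hS).mul_rd hv.Pm.pow).add (hv.pow.const_mul _)
  · exact ((hS.mul_rd hv.pow).mul_pb (PB_Ainv hc hα)).sub ((hA.mul_rd hv.Cm).mul hSv.Cm)
  · refine RD.add (RD.neg (PB.mul_rd (hA.mul ?_) (hv.shiftm 1).pow))
      (PB.mul_rd ((hA.shiftm 1).mul ?_) hv.pow)
    · exact ((PB.const _).mul (hS.shiftm 1)).add ((PB.const _).mul ((hS.shiftm 1).add (hS.shift 1)))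
    · exact ((PB.const _).mul hS).add ((PB.const _).mul ((hS.shiftm 2).add hS))
  · intro β
    have e1 : β + 1 - 1 = β := by ring
    have e2 : β + 1 - 2 = β - 1 := by ring
    have e3 : β + 1 + 1 = β + 2 := by ring
    simp only [Cm, Pm, e1, e2, e3]
    have k1 := Sv_div hc hα β
    have k2 := Sv_conv (by linarith : 1 ≤ α) β
    have k3 := Sv_two (by linarith : 1 ≤ α) β
    have a0 := Av_pos hc hα β
    have a1 := Av_le hc hα (β + 1)
    have a2 := Av_le hc hα (β - 1)
    have s0 := Sv_nonneg α β
    have s1 := Sv_nonneg α (β + 2)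
    have s2 := Sv_nonneg α (β - 2)
    have m1 : Av α (β + 1) * (1 / 4 * Sv α β + 1 / 8 * (Sv α β + Sv α (β + 2))) ≤
      (1 / 4 * Sv α β + 1 / 8 * (Sv α β + Sv α (β + 2))) := mul_le_of_le_one_left (by positivity) a1
    have m2 : Av α (β - 1) * (1 / 4 * Sv α β + 1 / 8 * (Sv α (β - 2) + Sv α β)) ≤
      (1 / 4 * Sv α β + 1 / 8 * (Sv α (β - 2) + Sv α β)) := mul_le_of_le_one_left (by positivity) a2
    have m3 : 0 ≤ v β ^ 2 * (Sv α β * (Av α β)⁻¹ - 1 / 2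
        - Av α (β + 1) * (1 / 4 * Sv α β + 1 / 8 * (Sv α β + Sv α (β + 2)))
        - Av α (β - 1) * (1 / 4 * Sv α β + 1 / 8 * (Sv α (β - 2) + Sv α β))) := by
      apply mul_nonneg (sq_nonneg _); linarith
    have m4 : 0 ≤ Av α β * (v (β - 1) + v (β + 1)) ^ 2 * (Sv α (β - 1) + Sv α (β + 1) - 2 * Sv α β) := by
      apply mul_nonneg (by positivity); linarith
    linear_combination m3 + m4 / 8

lemma sum_h {c₀ α : ℝ} (hc : 1 < c₀) (hα : c₀ ≤ α) {ν : ℝ} (hν : 0 ≤ ν) (a : ℝ) {v : ℤ → ℝ} (hv : RD v) :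
    ∑' β, (2 * (v β * dv α ν a v β) * (Av α β)⁻¹ - Av α β * (2 * (Cm v β * Cm (dv α ν a v) β))) ≤
      - ν * ∑' β, (2 * (Av α β * Sv α β * Pm v β ^ 2) + v β ^ 2) := by
  have hS := PB_S α
  have hA := PB_A hc hα
  have hSv : RD (fun b => Sv α b * v b) := hS.mul_rd hv
  have hz : RD (fun b => Av α b * Cm v b) := hA.mul_rd hv.Cm
  have h1 := sum_h_core hc hα hv
  have h2 := sum_xCx hv
  have h3 := sum_xCx hz
  have r1 : RD (fun β => v β * Cm v β) := hv.mul hv.Cm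
  have r2 := hz.mul hz.Cm
  have r3 := ((hS.mul_rd hv.pow).mul_pb (PB_Ainv hc hα)).sub ((hA.mul_rd hv.Cm).mul hSv.Cm)
  have : ∀ β, (2 * (v β * dv α ν a v β) * (Av α β)⁻¹ - Av α β * (2 * (Cm v β * Cm (dv α ν a v) β)))
     = (-2 * ν) * (Sv α β * v β ^ 2 * (Av α β)⁻¹ - Av α β * Cm v β * Cm (fun b => Sv α b * v b) β)
      + (2 * a * (v β * Cm v β) - 2 * a * ((Av α β * Cm v β) * Cm (fun b => Av α b * Cm v b) β)) := by
    intro β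
    have := (Av_pos hc hα β).ne'
    rw [Cm_dv]
    have e : v β * dv α ν a v β * (Av α β)⁻¹ = -ν * (Sv α β * v β ^ 2 * (Av α β)⁻¹) + a * (v β * Cm v β) := by
      unfold dv; field_simp
    linear_combination 2 * e
  simp_rw [this]
  rw [(r3.const_mul (-2 * ν)).summable.tsum_add ((r1.const_mul _).sub (r2.const_mul _)).summable,
    (r1.const_mul (2 * a)).summable.tsum_sub (r2.const_mul _).summable]
  simp only [tsum_mul_left]
  rw [h2, h3]
  have h4 : ∑' β, (2 * (Av α β * Sv α β * Pm v β ^ 2) + v β ^ 2) =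
      2 * ∑' β, (Av α β * Sv α β * Pm v β ^ 2 + 1 / 2 * v β ^ 2) := by
    rw [← tsum_mul_left]; congr 1; ext β; ring
  rw [h4]
  nlinarith

lemma h_lower {c₀ α : ℝ} (hc : 1 < c₀) (hα : c₀ ≤ α) {v : ℤ → ℝ} (hv : RD v) :
    ∑' β, Pm v β ^ 2 ≤ ∑' β, (v β ^ 2 * (Av α β)⁻¹ - Av α β * Cm v β ^ 2) := by
  have hA := PB_A hc hα
  apply tsum_le_tel (U := fun β => 1 / 2 * v β ^ 2 - 1 / 2 * v (β - 1) ^ 2) hv.Pm.pow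
  · exact (hv.pow.mul_pb (PB_Ainv hc hα)).sub (hA.mul_rd hv.Cm.pow)
  · exact (hv.pow.const_mul _).sub ((hv.shiftm 1).pow.const_mul _)
  · intro β
    have e1 : β + 1 - 1 = β := by ring
    simp only [Cm, Pm, e1]
    have a0 := Av_pos hc hα β
    have a1 := Av_le hc hα β
    have a2 : 1 ≤ (Av α β)⁻¹ := (one_le_inv₀ a0).mpr a1
    have m1 : 0 ≤ v β ^ 2 * ((Av α β)⁻¹ - 1) := mul_nonneg (sq_nonneg _) (by linarith)
    have m2 : 0 ≤ (1 - Av α β) * ((v (β - 1) - v (β + 1)) / 2) ^ 2 :=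
      mul_nonneg (by linarith) (sq_nonneg _)
    linear_combination m1 + m2

lemma Sinv_shift {c₀ α : ℝ} (hc : 1 < c₀) (hα : c₀ ≤ α) (β : ℤ) :
    (Sv α (β + 1))⁻¹ ≤ 2 * (Sv α β)⁻¹ ∧ (Sv α (β - 1))⁻¹ ≤ 2 * (Sv α β)⁻¹ := by
  have h0 := Sv_ge hc hα β
  have hp := Sv_ge hc hα (β + 1)
  have hm := Sv_ge hc hα (β - 1)
  have k1 := Sv_pred_le α (β + 1)
  have k2 := Sv_succ_le α (β - 1)
  simp only [add_sub_cancel_right, sub_add_cancel] at k1 k2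
  constructor <;>
  · rw [inv_eq_one_div, inv_eq_one_div, mul_one_div, div_le_div_iff₀ (by linarith) (by linarith)]
    linarith

lemma h_upper {c₀ α : ℝ} (hc : 1 < c₀) (hα : c₀ ≤ α) {v : ℤ → ℝ} (hv : RD v) :
    ∑' β, (v β ^ 2 * (Av α β)⁻¹ - Av α β * Cm v β ^ 2) ≤
      ∑' β, (Pm v β ^ 2 + 3 * (1 - c₀⁻¹)⁻¹ * ((Sv α β)⁻¹ * v β ^ 2)) := by
  have hA := PB_A hc hα
  have hS := PB_Sinv hc hα
  apply tsum_le_tel (U := fun β => -(1 / 2 * v β ^ 2 - 1 / 2 * v (β - 1) ^ 2)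
    - (1 / 2 * ((Sv α β)⁻¹ * v (β - 1) ^ 2)) + 1 / 2 * ((Sv α (β - 1))⁻¹ * v β ^ 2))
  · exact (hv.pow.mul_pb (PB_Ainv hc hα)).sub (hA.mul_rd hv.Cm.pow)
  · exact hv.Pm.pow.add ((hS.mul_rd hv.pow).const_mul _)
  · exact (((hv.pow.const_mul _).sub ((hv.shiftm 1).pow.const_mul _)).neg.sub
      ((hS.mul_rd (hv.shiftm 1).pow).const_mul _)).add (((hS.shiftm 1).mul_rd hv.pow).const_mul _)
  · intro β
    have e1 : β + 1 - 1 = β := by ring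
    simp only [Cm, Pm, e1]
    have a0 := Av_pos hc hα β
    have ak := Av_ge hc hα β
    have kp := kap_pos hc
    have s0 := Sv_ge hc hα β
    obtain ⟨s1, s2⟩ := Sinv_shift hc hα β
    have si : 0 < (Sv α β)⁻¹ := inv_pos.mpr (by linarith)
    have kk : 1 ≤ (1 - c₀⁻¹)⁻¹ := (one_le_inv₀ kp).mpr (kap_lt hc).le
    have a3 : (Av α β)⁻¹ ≤ 1 + (1 - c₀⁻¹)⁻¹ * (Sv α β)⁻¹ := by
      have : (Av α β)⁻¹ = 1 + (Av α β)⁻¹ * (Sv α β)⁻¹ := by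
        have : (Sv α β)⁻¹ = 1 - Av α β := by unfold Av; ring
        rw [this]; field_simp; ring
      rw [this]
      have : (Av α β)⁻¹ ≤ (1 - c₀⁻¹)⁻¹ := inv_anti₀ kp ak
      nlinarith
    have key : (Av α β)⁻¹ ≤ 1 + 3 * (1 - c₀⁻¹)⁻¹ * (Sv α β)⁻¹ - 1 / 2 * (Sv α (β + 1))⁻¹
        - 1 / 2 * (Sv α (β - 1))⁻¹ := by nlinarith
    have m1 := mul_nonneg (sq_nonneg (v β)) (sub_nonneg.mpr key)
    have m2 : 0 ≤ (Sv α β)⁻¹ * (v (β - 1) + v (β + 1)) ^ 2 := by positivity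
    have hAv : Av α β = 1 - (Sv α β)⁻¹ := rfl
    set A := (Av α β)⁻¹
    rw [hAv]
    linear_combination m1 + m2 / 4


noncomputable def fv (N : ℝ) (β : ℤ) : ℝ := ((β : ℝ) + 1 / 2) / (N + |(β : ℝ) + 1 / 2|)

lemma fv_neg (N : ℝ) (β : ℤ) : fv N (-1 - β) = - fv N β := by
  unfold fv
  push_cast
  have : (-1 - (β : ℝ) + 1 / 2) = -((β : ℝ) + 1 / 2) := by ring
  rw [this, abs_neg, neg_div]

lemma fv_abs_le {N : ℝ} (hN : 1 ≤ N) (β : ℤ) : |fv N β| ≤ 1 := by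
  unfold fv
  have h := abs_nonneg ((β : ℝ) + 1 / 2)
  rw [abs_div, abs_of_pos (by linarith : 0 < N + |(β : ℝ) + 1 / 2|), div_le_one (by linarith)]
  linarith

lemma fv_abs_le' {N : ℝ} (hN : 1 ≤ N) (β : ℤ) : |fv N β| ≤ (|(β : ℝ)| + 1 / 2) / N := by
  unfold fv
  have h := abs_nonneg ((β : ℝ) + 1 / 2)
  have h2 : |(β : ℝ) + 1 / 2| ≤ |(β : ℝ)| + 1 / 2 := by
    have := abs_add_le (β : ℝ) (1 / 2)
    rwa [abs_of_pos (by norm_num : (0 : ℝ) < 1 / 2)] at this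
  rw [abs_div, abs_of_pos (by linarith : 0 < N + |(β : ℝ) + 1 / 2|)]
  apply div_le_div₀ (by positivity) h2 (by linarith) (by linarith)

lemma fv_pos_eq (N : ℝ) {β : ℤ} (h : 0 ≤ β) : fv N β = ((β : ℝ) + 1 / 2) / (N + β + 1 / 2) := by
  have : (0 : ℝ) ≤ β := by exact_mod_cast h
  unfold fv
  rw [abs_of_pos (by linarith), add_assoc]

/-- discrete derivative of `f` -/
lemma fv_diff_pos {N : ℝ} (hN : 1 ≤ N) {β : ℤ} (h : 0 ≤ β) :
    N / (2 * (N + |(β : ℝ)|) ^ 2) ≤ fv N β - fv N (β - 1) ∧ fv N β - fv N (β - 1) ≤ 1 / N := by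
  have hb : (0 : ℝ) ≤ β := by exact_mod_cast h
  rw [abs_of_nonneg hb]
  rcases h.eq_or_lt with h0 | h0
  · subst h0
    have e : fv N (0 - 1) = - fv N 0 := by
      have := fv_neg N 0
      simpa using this
    rw [e, fv_pos_eq N le_rfl]
    simp only [Int.cast_zero, zero_add, add_zero]
    constructor
    · rw [sub_neg_eq_add, ← add_div, div_le_div_iff₀ (by positivity) (by positivity)]
      nlinarith
    · rw [sub_neg_eq_add, ← add_div, div_le_div_iff₀ (by positivity) (by positivity)]
      nlinarith
  · have h1 : (0 : ℤ) ≤ β - 1 := by omega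
    have hb1 : (1 : ℝ) ≤ β := by exact_mod_cast h0
    rw [fv_pos_eq N h, fv_pos_eq N h1]
    push_cast
    have e : ((β : ℝ) + 1 / 2) / (N + β + 1 / 2) - ((β : ℝ) - 1 + 1 / 2) / (N + (β - 1) + 1 / 2)
        = N / ((N + β + 1 / 2) * (N + β - 1 / 2)) := by
      obtain ⟨d, hd⟩ : ∃ d : ℝ, (β : ℝ) = d - N + 1 / 2 := ⟨N + β - 1 / 2, by ring⟩
      rw [hd]
      rw [hd] at hb1
      have d0 : d ≠ 0 := by linarith
      have d1 : d + 1 ≠ 0 := by linarith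
      have e1 : N + (d - N + 1 / 2) + 1 / 2 = d + 1 := by ring
      have e2 : N + (d - N + 1 / 2 - 1) + 1 / 2 = d := by ring
      have e3 : N + (d - N + 1 / 2) - 1 / 2 = d := by ring
      rw [e1, e2, e3]
      field_simp
      ring
    rw [e]
    have p1 : 0 < N + (β : ℝ) + 1 / 2 := by linarith
    have p2 : 0 < N + (β : ℝ) - 1 / 2 := by linarith
    constructor
    · apply div_le_div_of_nonneg_left (by linarith) (by positivity)
      nlinarith
    · rw [div_le_div_iff₀ (by positivity) (by positivity)]
      nlinarith

lemma fv_diff {N : ℝ} (hN : 1 ≤ N) (β : ℤ) :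
    N / (2 * (N + |(β : ℝ)|) ^ 2) ≤ fv N β - fv N (β - 1) ∧ fv N β - fv N (β - 1) ≤ 1 / N := by
  rcases le_total 0 β with h | h
  · exact fv_diff_pos hN h
  · have := fv_diff_pos hN (β := -β) (by omega)
    have e1 := fv_neg N β
    have e2 := fv_neg N (β - 1)
    have e3 : -1 - β = -β - 1 := by ring
    have e4 : -1 - (β - 1) = -β := by ring
    rw [e3] at e1
    rw [e4] at e2
    rw [e1, e2] at this
    push_cast at this
    rw [abs_neg] at this
    constructor <;> linarith [this.1, this.2]

noncomputable def Dv (α N : ℝ) (β : ℤ) : ℝ :=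
  Av α (β + 1) * ((3 * fv N β - fv N (β + 1)) / 2) - Av α (β - 1) * ((3 * fv N (β - 1) - fv N (β - 2)) / 2)

lemma Sv_neg (α : ℝ) (β : ℤ) : Sv α (-β) = Sv α β := by unfold Sv; push_cast; rw [neg_sq]

lemma Dv_neg (α N : ℝ) (β : ℤ) : Dv α N (-β) = Dv α N β := by
  unfold Dv Av
  have a1 : Sv α (-β + 1) = Sv α (β - 1) := by rw [← Sv_neg]; congr 1; ring
  have a2 : Sv α (-β - 1) = Sv α (β + 1) := by rw [← Sv_neg]; congr 1; ring
  have e1 : fv N (-β) = - fv N (β - 1) := by rw [← fv_neg]; congr 1; ring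
  have e2 : fv N (-β + 1) = - fv N (β - 2) := by rw [← fv_neg]; congr 1; ring
  have e3 : fv N (-β - 1) = - fv N β := by rw [← fv_neg]; congr 1; ring
  have e4 : fv N (-β - 2) = - fv N (β + 1) := by rw [← fv_neg]; congr 1; ring
  rw [a1, a2, e1, e2, e3, e4]; ring

lemma Av_diff {c₀ α : ℝ} (hc : 1 < c₀) (hα : c₀ ≤ α) {β : ℤ} (h : 0 ≤ β) :
    (β : ℝ) / (4 * Sv α β ^ 3) ≤ Av α (β + 1) - Av α (β - 1) := by
  have hb : (0 : ℝ) ≤ β := by exact_mod_cast h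
  have s0 := Sv_ge hc hα β
  have sp := Sv_ge hc hα (β + 1)
  have sm := Sv_ge hc hα (β - 1)
  have k1 := Sv_succ_le α β
  have k2 := Sv_pred_le α β
  have q1 := Sv_sq α (β + 1)
  have q2 := Sv_sq α (β - 1)
  push_cast at q1 q2
  unfold Av
  set x := Sv α (β + 1)
  set y := Sv α (β - 1)
  set s := Sv α β
  have hs : 0 < s := by linarith
  have hx : 0 < x := by linarith
  have hy : 0 < y := by linarith
  have e : 1 - x⁻¹ - (1 - y⁻¹) = 4 * β / (x * y * (x + y)) := by
    have : (x - y) * (x + y) = 4 * β := by linear_combination q1 - q2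
    rw [← this]; field_simp; ring
  rw [e]
  have hxy : x * y * (x + y) ≤ 16 * s ^ 3 := by
    have : x * y ≤ (2 * s) * (2 * s) := mul_le_mul (by linarith) (by linarith) hy.le (by linarith)
    calc x * y * (x + y) ≤ ((2 * s) * (2 * s)) * (4 * s) :=
          mul_le_mul this (by linarith) (by linarith) (by positivity)
      _ = _ := by ring
  rw [div_le_div_iff₀ (by positivity) (by positivity)]
  nlinarith

lemma Dv_pos {c₀ α N : ℝ} (hc : 1 < c₀) (hα : c₀ ≤ α) (hN : 1 ≤ N) {β : ℤ} (h : 1 ≤ β) :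
    (β : ℝ) ^ 2 / (8 * (N + |(β : ℝ)|) * Sv α β ^ 3) - 6 / N ^ 3 ≤ Dv α N β := by
  have hb : (1 : ℝ) ≤ β := by exact_mod_cast h
  have s0 := Sv_ge hc hα β
  have hd := Av_diff hc hα (β := β) (by omega)
  rw [abs_of_nonneg (by linarith)]
  have ap := Av_le hc hα (β + 1)
  have am := Av_le hc hα (β - 1)
  have am0 := Av_pos hc hα (β - 1)
  have ap0 := Av_pos hc hα (β + 1)
  set x : ℝ := (β : ℝ) with hx
  have f0 : fv N β = (x + 1 / 2) / (N + x + 1 / 2) := fv_pos_eq N (by omega)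
  have f1 : fv N (β + 1) = (x + 3 / 2) / (N + x + 3 / 2) := by
    rw [fv_pos_eq N (by omega)]; push_cast; congr 1 <;> ring
  have fm : fv N (β - 1) = (x - 1 / 2) / (N + x - 1 / 2) := by
    rw [fv_pos_eq N (by omega)]; push_cast; congr 1 <;> ring
  have fmm : (x - 3 / 2) / (N + x - 3 / 2) ≤ fv N (β - 2) := by
    rcases h.eq_or_lt with h1 | h1
    · have e : fv N (β - 2) = - fv N 0 := by rw [← fv_neg, ← h1]; norm_num
      have hx1 : x = 1 := by rw [hx, ← h1]; norm_num
      rw [e, fv_pos_eq N le_rfl, hx1, ← neg_div, div_le_div_iff₀ (by linarith) (by simp; linarith)]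
      norm_num; linarith
    · rw [fv_pos_eq N (by omega)]; push_cast; apply le_of_eq; congr 1 <;> ring
  have n1 : 0 < N + x - 3 / 2 := by linarith
  have n2 : 0 < N + x - 1 / 2 := by linarith
  have n3 : 0 < N + x + 1 / 2 := by linarith
  have n4 : 0 < N + x + 3 / 2 := by linarith
  set p := (3 * fv N β - fv N (β + 1)) / 2 with hp
  set r := (3 * fv N (β - 1) - (x - 3 / 2) / (N + x - 3 / 2)) / 2 with hr
  have hpr : p - r = - (3 * N / ((N + x - 3 / 2) * (N + x - 1 / 2) * (N + x + 1 / 2) * (N + x + 3 / 2))) := by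
    rw [hp, hr, f0, f1, fm]
    clear_value x
    obtain ⟨d, hd⟩ : ∃ d : ℝ, x = d - N + 3 / 2 := ⟨N + x - 3 / 2, by ring⟩
    have e1 : N + x + 3 / 2 = d + 3 := by rw [hd]; ring
    have e2 : N + x + 1 / 2 = d + 2 := by rw [hd]; ring
    have e3 : N + x - 1 / 2 = d + 1 := by rw [hd]; ring
    have e4 : N + x - 3 / 2 = d := by rw [hd]; ring
    rw [e4] at n1
    rw [e1, e2, e3, e4, hd]
    field_simp
    ring
  have hprod : N ^ 4 / 2 ≤ (N + x - 3 / 2) * (N + x - 1 / 2) * (N + x + 1 / 2) * (N + x + 3 / 2) := by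
    have a1 : N / 2 * N ≤ (N + x - 3 / 2) * (N + x - 1 / 2) :=
      mul_le_mul (by linarith) (by linarith) (by linarith) n1.le
    have a2 : N / 2 * N * N ≤ (N + x - 3 / 2) * (N + x - 1 / 2) * (N + x + 1 / 2) :=
      mul_le_mul a1 (by linarith) (by linarith) (by positivity)
    have a3 : N / 2 * N * N * N ≤ (N + x - 3 / 2) * (N + x - 1 / 2) * (N + x + 1 / 2) * (N + x + 3 / 2) :=
      mul_le_mul a2 (by linarith) (by linarith) (by positivity)
    linarith
  have hpr2 : 3 * N / ((N + x - 3 / 2) * (N + x - 1 / 2) * (N + x + 1 / 2) * (N + x + 3 / 2)) ≤ 6 / N ^ 3 := by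
    rw [div_le_div_iff₀ (by positivity) (by positivity)]
    linarith
  have hpr3 : 0 ≤ 3 * N / ((N + x - 3 / 2) * (N + x - 1 / 2) * (N + x + 1 / 2) * (N + x + 3 / 2)) := by
    positivity
  have hpl : x / (2 * (N + x)) ≤ p := by
    have : x / (N + x) ≤ fv N β := by
      rw [f0, div_le_div_iff₀ (by linarith) (by linarith)]; nlinarith
    have h2 : fv N (β + 1) ≤ 2 * fv N β := by
      rw [f0, f1, mul_div_assoc', div_le_div_iff₀ (by linarith) (by linarith)]; nlinarith
    have h3 : x / (2 * (N + x)) = x / (N + x) / 2 := by field_simp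
    rw [h3]; linarith
  have hD : Av α (β + 1) * p - Av α (β - 1) * r ≤ Dv α N β := by
    unfold Dv
    have : (3 * fv N (β - 1) - fv N (β - 2)) / 2 ≤ r := by rw [hr]; linarith
    have := mul_le_mul_of_nonneg_left this am0.le
    exact sub_le_sub_left this _
  have hp0 : 0 ≤ x / (2 * (N + x)) := by positivity
  have hS0 : 0 < Sv α β := by linarith
  have hd0 : 0 ≤ x / (4 * Sv α β ^ 3) := by positivity
  have key : x ^ 2 / (8 * (N + x) * Sv α β ^ 3) = (x / (4 * Sv α β ^ 3)) * (x / (2 * (N + x))) := by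
    field_simp; ring
  rw [key]
  have hm := mul_le_mul hd hpl hp0 (by linarith)
  refine le_trans ?_ hD
  have e : Av α (β + 1) * p - Av α (β - 1) * r = (Av α (β + 1) - Av α (β - 1)) * p + Av α (β - 1) * (p - r) := by ring
  rw [e, hpr]
  nlinarith

lemma Dv_ge {c₀ α N : ℝ} (hc : 1 < c₀) (hα : c₀ ≤ α) (hN : 1 ≤ N) (β : ℤ) :
    (β : ℝ) ^ 2 / (8 * (N + |(β : ℝ)|) * Sv α β ^ 3) - 6 / N ^ 3 ≤ Dv α N β := by
  rcases lt_trichotomy β 0 with h | h | h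
  · have := Dv_pos hc hα hN (β := -β) (by omega)
    rw [Dv_neg, Sv_neg] at this
    push_cast at this
    rwa [abs_neg, neg_sq] at this
  · subst h
    have e1 : fv N (0 - 1) = - fv N 0 := by rw [← fv_neg]; congr 1
    have e2 : fv N (0 - 2) = - fv N (0 + 1) := by rw [← fv_neg]; congr 1
    have e3 : Av α (0 - 1) = Av α (0 + 1) := by
      unfold Av; rw [← Sv_neg]; congr 1
    have ap := Av_pos hc hα (0 + 1)
    unfold Dv
    rw [e1, e2, e3]
    have h2 : fv N (0 + 1) ≤ 3 * fv N 0 := by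
      rw [fv_pos_eq N (by norm_num), fv_pos_eq N (by norm_num), mul_div_assoc',
        div_le_div_iff₀ (by norm_num; linarith) (by norm_num; linarith)]
      push_cast; nlinarith
    have h3 : (0 : ℝ) < 6 / N ^ 3 := by positivity
    have h4 : 0 ≤ Av α (0 + 1) * (3 * fv N 0 - fv N (0 + 1)) := mul_nonneg ap.le (by linarith)
    have h5 : ((0 : ℤ) : ℝ) ^ 2 / (8 * (N + |((0 : ℤ) : ℝ)|) * Sv α 0 ^ 3) = 0 := by simp
    rw [h5]
    generalize Av α (0 + 1) = A at *
    generalize fv N (0 + 1) = g at *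
    generalize 6 / N ^ 3 = m at *
    linear_combination h4 + h3.le
  · exact Dv_pos hc hα hN (by omega)

lemma PB_f {N : ℝ} (hN : 1 ≤ N) : PB (fv N) := PB.of_bdd 1 (fv_abs_le hN)

lemma PB_D {c₀ α N : ℝ} (hc : 1 < c₀) (hα : c₀ ≤ α) (hN : 1 ≤ N) : PB (Dv α N) := by
  have hA := PB_A hc hα
  have hf := PB_f hN
  have := ((hA.shift 1).mul (((PB.const 3).mul hf).sub (hf.shift 1))).sub
    ((hA.shiftm 1).mul (((PB.const 3).mul (hf.shiftm 1)).sub (hf.shiftm 2)))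
  have := (PB.const (1 / 2)).mul this
  refine (congrArg PB ?_).mp this
  ext β; unfold Dv; ring


lemma virial {c₀ α N : ℝ} (hc : 1 < c₀) (hα : c₀ ≤ α) (hN : 1 ≤ N) (ν a : ℝ) {v : ℤ → ℝ} (hv : RD v) :
    ∑' β, fv N β * (dv α ν a v β * v (β + 1) + v β * dv α ν a v (β + 1)) =
      ∑' β, (a / 2 * (Dv α N β * v β ^ 2 + 2 * (Av α β * (fv N β - fv N (β - 1)) * Pm v β ^ 2))
        - ν * (fv N β * (Sv α β + Sv α (β + 1)) * (v β * v (β + 1)))) := by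
  have hA := PB_A hc hα
  have hS := PB_S α
  have hf := PB_f hN
  have hD := PB_D hc hα hN
  have hd := hv.dv hc hα ν a
  apply tsum_eq_tel (U := fun β => a / 2 * (-(fv N (β - 1) * Av α (β - 1) * v β ^ 2)
    - fv N (β - 1) * Av α β * (v (β - 1) * v (β + 1))
    + 1 / 2 * (Av α β * (fv N β - fv N (β - 1)) * v (β - 1) ^ 2)
    - 1 / 2 * (Av α (β - 1) * (fv N (β - 1) - fv N (β - 2)) * v β ^ 2)))
  · exact hf.mul_rd ((hd.mul (hv.shift 1)).add (hv.mul (hd.shift 1)))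
  · exact (((hD.mul_rd hv.pow).add (((hA.mul (hf.sub (hf.shiftm 1))).mul_rd hv.Pm.pow).const_mul _)).const_mul _).sub
      (((hf.mul (hS.add (hS.shift 1))).mul_rd (hv.mul (hv.shift 1))).const_mul _)
  · exact ((((((hf.shiftm 1).mul (hA.shiftm 1)).mul_rd hv.pow).neg.sub
      (((hf.shiftm 1).mul hA).mul_rd ((hv.shiftm 1).mul (hv.shift 1)))).add
      (((hA.mul (hf.sub (hf.shiftm 1))).mul_rd (hv.shiftm 1).pow).const_mul _)).sub
      ((((hA.shiftm 1).mul ((hf.shiftm 1).sub (hf.shiftm 2))).mul_rd hv.pow).const_mul _)).const_mul _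
  · intro β
    have e1 : β + 1 - 1 = β := by ring
    have e2 : β + 1 - 2 = β - 1 := by ring
    simp only [dv, Cm, Pm, Dv, e1, e2]
    ring

lemma fbar {N : ℝ} (hN : 1 ≤ N) (β : ℤ) : |fv N β + fv N (β - 1)| ≤ 2 := by
  have := fv_abs_le hN β
  have := fv_abs_le hN (β - 1)
  have := abs_add_le (fv N β) (fv N (β - 1))
  linarith

lemma fbar' {c₀ α N : ℝ} (hc : 1 < c₀) (hα : c₀ ≤ α) (hN : 1 ≤ N) (β : ℤ) :
    |fv N β + fv N (β - 1)| ≤ 2 * (2 * Sv α β / N) := by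
  have h1 := fv_abs_le' hN β
  have h2 := fv_abs_le' hN (-β)
  have e : fv N (-β) = - fv N (β - 1) := by rw [← fv_neg]; congr 1; ring
  rw [e, abs_neg] at h2
  push_cast at h2
  rw [abs_neg] at h2
  have := abs_add_le (fv N β) (fv N (β - 1))
  have s0 := Sv_ge hc hα β
  have s1 := abs_le_Sv α β
  have h3 : (|(β : ℝ)| + 1 / 2) / N ≤ 2 * Sv α β / N :=
    div_le_div_of_nonneg_right (by linarith) (by linarith)
  linarith

lemma T_bound {c₀ α N : ℝ} (hc : 1 < c₀) (hα : c₀ ≤ α) (hN : 1 ≤ N) {v : ℤ → ℝ} (hv : RD v) :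
    ∑' β, fv N β * (Sv α β + Sv α (β + 1)) * (v β * v (β + 1)) ≤
      ∑' β, (2 * (Sv α β * (|v β| * |Pm v β|)) + 2 / N * (Sv α β * v β ^ 2)) := by
  have hS := PB_S α
  have hf := PB_f hN
  apply tsum_le_tel (U := fun β => fv N (β - 1) * Sv α β * (v (β - 1) * v β)
    + 1 / (4 * N) * (Sv α (β - 1) * v β ^ 2) - 1 / (4 * N) * (Sv α β * v (β - 1) ^ 2))
  · exact (hf.mul (hS.add (hS.shift 1))).mul_rd (hv.mul (hv.shift 1))
  · exact ((hS.mul_rd (hv.abs.mul hv.Pm.abs)).const_mul _).add ((hS.mul_rd hv.pow).const_mul _)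
  · exact ((((hf.shiftm 1).mul hS).mul_rd ((hv.shiftm 1).mul hv)).add
      (((hS.shiftm 1).mul_rd hv.pow).const_mul _)).sub ((hS.mul_rd (hv.shiftm 1).pow).const_mul _)
  · intro β
    have e1 : β + 1 - 1 = β := by ring
    simp only [e1]
    have fb := fbar hN β
    obtain ⟨fd0, fd⟩ := fv_diff hN β
    have fdn : 0 ≤ fv N β - fv N (β - 1) := le_trans (by positivity) fd0
    have s0 := Sv_ge hc hα β
    have sp := Sv_succ_le α β
    have sm := Sv_pred_le α β
    have hp : v (β + 1) + v (β - 1) = 2 * Pm v β := by unfold Pm; ring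
    set P := Pm v β
    set s := Sv α β
    set f := fv N β
    set g := fv N (β - 1)
    have hs : 0 < s := by linarith
    -- main pointwise
    have m1 : v β * ((f + g) * P) ≤ 2 * (|v β| * |P|) := by
      calc v β * ((f + g) * P) ≤ |v β * ((f + g) * P)| := le_abs_self _
        _ = |f + g| * (|v β| * |P|) := by rw [abs_mul, abs_mul]; ring
        _ ≤ 2 * (|v β| * |P|) := mul_le_mul_of_nonneg_right fb (by positivity)
    have m2 : 1 / 2 * ((f - g) * (v β * (v (β + 1) - v (β - 1)))) ≤
        1 / (2 * N) * (v β ^ 2 + 1 / 2 * v (β + 1) ^ 2 + 1 / 2 * v (β - 1) ^ 2) := by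
      have : v β * (v (β + 1) - v (β - 1)) ≤ v β ^ 2 + 1 / 2 * v (β + 1) ^ 2 + 1 / 2 * v (β - 1) ^ 2 := by
        nlinarith [sq_nonneg (v β - v (β + 1)), sq_nonneg (v β + v (β - 1))]
      calc 1 / 2 * ((f - g) * (v β * (v (β + 1) - v (β - 1)))) ≤
          1 / 2 * ((f - g) * (v β ^ 2 + 1 / 2 * v (β + 1) ^ 2 + 1 / 2 * v (β - 1) ^ 2)) := by gcongr
        _ ≤ 1 / 2 * (1 / N * (v β ^ 2 + 1 / 2 * v (β + 1) ^ 2 + 1 / 2 * v (β - 1) ^ 2)) := by gcongr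
        _ = _ := by field_simp
    have m3 := mul_le_mul_of_nonneg_left (add_le_add m1 m2) hs.le
    have m4 : 1 / (4 * N) * (Sv α (β + 1) * v β ^ 2) ≤ 1 / (4 * N) * ((2 * s) * v β ^ 2) := by gcongr; linarith
    have m5 : 1 / (4 * N) * (Sv α (β - 1) * v β ^ 2) ≤ 1 / (4 * N) * ((2 * s) * v β ^ 2) := by gcongr; linarith
    have hP : P = (v (β + 1) + v (β - 1)) / 2 := by rw [hp]; ring
    have m6 : 2 / N * (s * v β ^ 2) = 1 / (4 * N) * (8 * (s * v β ^ 2)) := by field_simp; ring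
    have m7 : 0 ≤ 1 / (4 * N) * (s * v β ^ 2) := by positivity
    have m8 : 1 / (2 * N) = 2 * (1 / (4 * N)) := by field_simp; norm_num
    rw [m6]
    rw [m8] at m3
    generalize 1 / (4 * N) = k at *
    have hpv : (f * (s + Sv α (β + 1)) * (v β * v (β + 1))) - (f * Sv α (β + 1) * (v β * v (β + 1)) - g * s * (v (β - 1) * v β))
      = s * (v β * ((f + g) * P) + 1 / 2 * ((f - g) * (v β * (v (β + 1) - v (β - 1))))) := by
      rw [hP]; ring
    linarith

lemma V_bound {c₀ α N : ℝ} (hc : 1 < c₀) (hα : c₀ ≤ α) (hN : 1 ≤ N) {v : ℤ → ℝ} (hv : RD v)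
    (ε : ℝ) (hε : |ε| = 1) :
    ε * ∑' β, fv N β * (v β * v (β + 1)) ≤
      ∑' β, (min 1 (2 * Sv α β / N) * (|v β| * |Pm v β|) + 1 / N * v β ^ 2) := by
  have hS := PB_S α
  have hf := PB_f hN
  have ho : PB (fun β => min 1 (2 * Sv α β / N)) := PB.of_bdd 1 (fun β => by
    have := Sv_nonneg α β
    rw [abs_of_nonneg (le_min zero_le_one (by positivity))]
    exact min_le_left _ _)
  rw [← tsum_mul_left]
  apply tsum_le_tel (U := fun β => ε * (1 / 2 * (fv N (β - 1) * (v (β - 1) * v β)))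
    + 1 / (8 * N) * v β ^ 2 - 1 / (8 * N) * v (β - 1) ^ 2)
  · exact (hf.mul_rd (hv.mul (hv.shift 1))).const_mul _
  · exact (ho.mul_rd (hv.abs.mul hv.Pm.abs)).add (hv.pow.const_mul _)
  · exact ((((hf.shiftm 1).mul_rd ((hv.shiftm 1).mul hv)).const_mul _).const_mul _ |>.add
      (hv.pow.const_mul _)).sub ((hv.shiftm 1).pow.const_mul _)
  · intro β
    have e1 : β + 1 - 1 = β := by ring
    simp only [e1]
    have fb : |fv N β + fv N (β - 1)| ≤ 2 * min 1 (2 * Sv α β / N) := by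
      rw [mul_min_of_nonneg _ _ (by norm_num : (0 : ℝ) ≤ 2)]
      exact le_min (by simpa using fbar hN β) (fbar' hc hα hN β)
    obtain ⟨fd0, fd⟩ := fv_diff hN β
    have fdn : 0 ≤ fv N β - fv N (β - 1) := le_trans (by positivity) fd0
    have hp : v (β + 1) + v (β - 1) = 2 * Pm v β := by unfold Pm; ring
    set P := Pm v β
    set o := min 1 (2 * Sv α β / N)
    set f := fv N β
    set g := fv N (β - 1)
    have m1 : ε * (v β * ((f + g) * P)) ≤ 2 * o * (|v β| * |P|) := by
      calc ε * (v β * ((f + g) * P)) ≤ |ε * (v β * ((f + g) * P))| := le_abs_self _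
        _ = |f + g| * (|v β| * |P|) := by rw [abs_mul, abs_mul, abs_mul, hε]; ring
        _ ≤ _ := mul_le_mul_of_nonneg_right fb (by positivity)
    have m2 : ε * (1 / 2 * ((f - g) * (v β * (v (β + 1) - v (β - 1))))) ≤
        1 / (2 * N) * (v β ^ 2 + 1 / 2 * v (β + 1) ^ 2 + 1 / 2 * v (β - 1) ^ 2) := by
      have : ε * (v β * (v (β + 1) - v (β - 1))) ≤ v β ^ 2 + 1 / 2 * v (β + 1) ^ 2 + 1 / 2 * v (β - 1) ^ 2 := by
        rcases eq_or_eq_neg_of_abs_eq hε with h | h <;> subst h <;>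
        nlinarith [sq_nonneg (v β - v (β + 1)), sq_nonneg (v β + v (β - 1)), sq_nonneg (v β + v (β + 1)), sq_nonneg (v β - v (β - 1))]
      calc ε * (1 / 2 * ((f - g) * (v β * (v (β + 1) - v (β - 1))))) 
          = 1 / 2 * ((f - g) * (ε * (v β * (v (β + 1) - v (β - 1))))) := by ring
        _ ≤ 1 / 2 * ((f - g) * (v β ^ 2 + 1 / 2 * v (β + 1) ^ 2 + 1 / 2 * v (β - 1) ^ 2)) := by gcongr
        _ ≤ 1 / 2 * (1 / N * (v β ^ 2 + 1 / 2 * v (β + 1) ^ 2 + 1 / 2 * v (β - 1) ^ 2)) := by gcongr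
        _ = _ := by field_simp
    have hP : P = (v (β + 1) + v (β - 1)) / 2 := by rw [hp]; ring
    have m6 : 1 / N * (v β ^ 2) = 1 / (8 * N) * (8 * (v β ^ 2)) := by field_simp
    have m7 : 0 ≤ 1 / (8 * N) * (v β ^ 2) := by positivity
    have m8 : 1 / (2 * N) = 4 * (1 / (8 * N)) := by field_simp; norm_num
    rw [m6]
    rw [m8] at m2
    generalize 1 / (8 * N) = k at *
    have hpv : ε * (f * (v β * v (β + 1))) - (ε * (1 / 2 * (f * (v β * v (β + 1)))) - ε * (1 / 2 * (g * (v (β - 1) * v β))))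
      = 1 / 2 * (ε * (v β * ((f + g) * P)) + ε * (1 / 2 * ((f - g) * (v β * (v (β + 1) - v (β - 1)))))) := by
      rw [hP]; ring
    linarith


noncomputable def mv (α : ℝ) (β : ℤ) : ℝ := (β : ℝ) / Sv α β ^ 2
noncomputable def phi (N : ℝ) (β : ℤ) : ℝ := N ^ 2 / (N + |(β : ℝ)|) ^ 2

lemma Sv_half {c₀ α : ℝ} (hc : 1 < c₀) (hα : c₀ ≤ α) (β : ℤ) :
    Sv α β ≤ 2 * Sv α (β + 1) ∧ Sv α β ≤ 2 * Sv α (β - 1) := by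
  have hp := Sv_ge hc hα (β + 1)
  have hm := Sv_ge hc hα (β - 1)
  have k1 := Sv_pred_le α (β + 1)
  have k2 := Sv_succ_le α (β - 1)
  simp only [add_sub_cancel_right, sub_add_cancel] at k1 k2
  constructor <;> linarith

lemma mv_diff {c₀ α N : ℝ} (hc : 1 < c₀) (hα : c₀ ≤ α) (hN : 1 ≤ N) (β : ℤ) :
    1 / (2 * Sv α β ^ 2) ≤ mv α (β + 1) - mv α (β - 1)
      + 64 * (2 * (N / (N + |(β : ℝ)|) * ((β : ℝ) ^ 2 / Sv α β ^ 3)) + 1 / N ^ 2) := by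
  have s0 := Sv_ge hc hα β
  have sp := Sv_ge hc hα (β + 1)
  have sm := Sv_ge hc hα (β - 1)
  obtain ⟨h1, h2⟩ := Sv_half hc hα β
  have q0 := Sv_sq α β
  have q1 := Sv_sq α (β + 1)
  have q2 := Sv_sq α (β - 1)
  push_cast at q1 q2
  unfold mv
  push_cast
  set b : ℝ := (β : ℝ)
  set x := Sv α (β + 1)
  set y := Sv α (β - 1)
  set s := Sv α β
  have hs : 0 < s := by linarith
  have hx : 0 < x := by linarith
  have hy : 0 < y := by linarith
  have e : (b + 1) / x ^ 2 - (b - 1) / y ^ 2 = 2 * (s ^ 2 + 1) / (x ^ 2 * y ^ 2) - 4 * b ^ 2 / (x ^ 2 * y ^ 2) := by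
    have : (b + 1) * y ^ 2 - (b - 1) * x ^ 2 = 2 * (s ^ 2 + 1) - 4 * b ^ 2 := by
      rw [q0, q1, q2]; ring
    rw [← sub_div, ← this]; field_simp
  have u1 : x ^ 2 * y ^ 2 ≤ (s ^ 2 + 1) ^ 2 := by
    rw [q0, q1, q2]; nlinarith [sq_nonneg b]
  have u2 : s ^ 4 ≤ 16 * (x ^ 2 * y ^ 2) := by
    have a1 : s ^ 2 ≤ 4 * x ^ 2 := by nlinarith
    have a2 : s ^ 2 ≤ 4 * y ^ 2 := by nlinarith
    calc s ^ 4 = s ^ 2 * s ^ 2 := by ring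
      _ ≤ (4 * x ^ 2) * (4 * y ^ 2) := mul_le_mul a1 a2 (by positivity) (by positivity)
      _ = _ := by ring
  have l1 : 1 / (2 * s ^ 2) ≤ 2 * (s ^ 2 + 1) / (x ^ 2 * y ^ 2) := by
    rw [div_le_div_iff₀ (by positivity) (by positivity)]
    nlinarith
  have l2 : 4 * b ^ 2 / (x ^ 2 * y ^ 2) ≤ 64 * (b ^ 2 / s ^ 4) := by
    rw [mul_div_assoc', div_le_div_iff₀ (by positivity) (by positivity)]
    nlinarith [mul_le_mul_of_nonneg_left u2 (sq_nonneg b)]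
  have l3 : b ^ 2 / s ^ 4 ≤ 2 * (N / (N + |b|) * (b ^ 2 / s ^ 3)) + 1 / N ^ 2 := by
    have hb := abs_nonneg b
    have hb2 := sq_abs b
    have hbs : b ^ 2 ≤ s ^ 2 := by rw [q0]; nlinarith [sq_nonneg α]
    have c1 : b ^ 2 / s ^ 4 ≤ b ^ 2 / s ^ 3 := by
      apply div_le_div_of_nonneg_left (sq_nonneg _) (by positivity)
      exact pow_le_pow_right₀ (by linarith) (by norm_num)
    have c2 : 0 ≤ b ^ 2 / s ^ 3 := by positivity
    rcases le_total |b| N with h | h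
    · have : 1 / 2 ≤ N / (N + |b|) := by
        rw [div_le_div_iff₀ (by norm_num) (by linarith)]; linarith
      have hh : 0 < 1 / N ^ 2 := by positivity
      have := mul_le_mul_of_nonneg_right this c2
      linarith
    · have : 1 / s ^ 2 ≤ 1 / N ^ 2 := by
        apply one_div_le_one_div_of_le (by positivity)
        have := pow_le_pow_left₀ (by linarith) h 2
        linarith
      have c3 : b ^ 2 / s ^ 4 ≤ 1 / s ^ 2 := by
        rw [div_le_div_iff₀ (by positivity) (by positivity)]
        have := mul_le_mul_of_nonneg_right hbs (sq_nonneg s)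
        linear_combination this
      have : 0 ≤ N / (N + |b|) * (b ^ 2 / s ^ 3) := by positivity
      linarith
  rw [e]
  linarith

/-- product bound in the uncertainty principle. -/
lemma unc_pt {c₀ α N ε : ℝ} (hc : 1 < c₀) (hα : c₀ ≤ α) (hN : 1 ≤ N) (hε : 0 < ε) (β : ℤ) (p q : ℝ) :
    4 * (ε * α * mv α β) * p * q ≤ 1 / 2 * α * (1 - c₀⁻¹) * phi N β * p ^ 2
      + 16 * ε ^ 2 * α / (1 - c₀⁻¹) * (1 / Sv α β ^ 2 + 1 / N ^ 2) * q ^ 2 := by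
  have kp := kap_pos hc
  set κ := 1 - c₀⁻¹
  have s0 := Sv_ge hc hα β
  have q0 := Sv_sq α β
  unfold mv phi
  set b : ℝ := (β : ℝ)
  set s := Sv α β
  have hs : 0 < s := by linarith
  have ha : 0 < α := by linarith
  have hb := abs_nonneg b
  have hb2 := sq_abs b
  have hbs : b ^ 2 ≤ s ^ 2 := by rw [q0]; nlinarith [sq_nonneg α]
  set F := N ^ 2 / (N + |b|) ^ 2 with hF
  have hFp : 0 < F := by positivity
  have k1 : (b / s ^ 2) ^ 2 / F ≤ 2 * (1 / s ^ 2 + 1 / N ^ 2) := by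
    have e : (b / s ^ 2) ^ 2 / F = b ^ 2 * (N + |b|) ^ 2 / (s ^ 4 * N ^ 2) := by
      rw [hF]; field_simp
    have e2 : 2 * (1 / s ^ 2 + 1 / N ^ 2) = 2 * (N ^ 2 * s ^ 2 + s ^ 4) / (s ^ 4 * N ^ 2) := by
      field_simp
    rw [e, e2]
    apply div_le_div_of_nonneg_right _ (by positivity)
    have a1 : (N + |b|) ^ 2 ≤ 2 * (N ^ 2 + b ^ 2) := by nlinarith [sq_nonneg (N - |b|)]
    calc b ^ 2 * (N + |b|) ^ 2 ≤ b ^ 2 * (2 * (N ^ 2 + b ^ 2)) := by gcongr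
      _ ≤ s ^ 2 * (2 * (N ^ 2 + s ^ 2)) := by gcongr
      _ = _ := by ring
  have amgm : 4 * (ε * α * (b / s ^ 2)) * p * q ≤ 1 / 2 * α * κ * F * p ^ 2
      + 8 * ε ^ 2 * α / κ * ((b / s ^ 2) ^ 2 / F) * q ^ 2 := by
    generalize b / s ^ 2 = m
    have e : 1 / 2 * α * κ * F * p ^ 2 + 8 * ε ^ 2 * α / κ * (m ^ 2 / F) * q ^ 2 - 4 * (ε * α * m) * p * q
      = α / (2 * (κ * F)) * (κ * F * p - 4 * ε * m * q) ^ 2 := by field_simp; ring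
    have : 0 ≤ α / (2 * (κ * F)) * (κ * F * p - 4 * ε * m * q) ^ 2 := by positivity
    linarith
  refine amgm.trans ?_
  have : 8 * ε ^ 2 * α / κ * ((b / s ^ 2) ^ 2 / F) * q ^ 2 ≤
      8 * ε ^ 2 * α / κ * (2 * (1 / s ^ 2 + 1 / N ^ 2)) * q ^ 2 := by gcongr
  have e : 8 * ε ^ 2 * α / κ * (2 * (1 / s ^ 2 + 1 / N ^ 2)) * q ^ 2 =
    16 * ε ^ 2 * α / κ * (1 / s ^ 2 + 1 / N ^ 2) * q ^ 2 := by ring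
  linarith

lemma coer_pt {c₀ α N ε : ℝ} (hc : 1 < c₀) (hα : c₀ ≤ α) (hN : 1 ≤ N) (hε : 0 < ε) (hε1 : ε ≤ 1 / 4) (β : ℤ) :
    ε / 8 * phi N β * (Sv α β)⁻¹ ≤ α * (ε / 4 * (1 / Sv α β ^ 2)
      + 1 / 16 * (N / (N + |(β : ℝ)|) * ((β : ℝ) ^ 2 / Sv α β ^ 3))) := by
  have s0 := Sv_ge hc hα β
  have q0 := Sv_sq α β
  unfold phi
  set b : ℝ := (β : ℝ)
  set s := Sv α β
  have hs : 0 < s := by linarith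
  have ha : 0 < α := by linarith
  have hb := abs_nonneg b
  set g := N / (N + |b|) with hg
  have hg0 : 0 ≤ g := by positivity
  have hg1 : g ≤ 1 := by rw [hg, div_le_one (by linarith)]; linarith
  have e : N ^ 2 / (N + |b|) ^ 2 = g ^ 2 := by rw [hg, div_pow]
  rw [e]
  have hsi : 0 < s⁻¹ := by positivity
  have p1 : 0 ≤ g * (b ^ 2 / s ^ 3) := by positivity
  have p2 : 0 ≤ ε / 4 * (1 / s ^ 2) := by positivity
  rcases le_total (s ^ 2) (2 * b ^ 2) with h | h
  · have : 1 / 2 * s⁻¹ ≤ b ^ 2 / s ^ 3 := by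
      rw [← div_eq_mul_inv, div_le_div_iff₀ hs (by positivity)]; nlinarith [mul_le_mul_of_nonneg_left h hs.le]
    have h2 : g * (1 / 2 * s⁻¹) ≤ g * (b ^ 2 / s ^ 3) := by gcongr
    have h3 : ε / 8 * g ^ 2 * s⁻¹ ≤ 1 / 32 * g * s⁻¹ := by
      have : ε / 8 * g ^ 2 ≤ 1 / 32 * g := by nlinarith
      gcongr
    have h4 : 1 * (1 / 16 * (g * (b ^ 2 / s ^ 3))) ≤ α * (ε / 4 * (1 / s ^ 2) + 1 / 16 * (g * (b ^ 2 / s ^ 3))) := by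
      apply mul_le_mul (by linarith) (by linarith) (by positivity) ha.le
    linarith
  · have has : s ≤ 2 * α := by
      apply le_of_sq_le_sq _ (by positivity)
      nlinarith
    have h1 : 1 / 2 * s⁻¹ ≤ α * (1 / s ^ 2) := by
      rw [← div_eq_mul_inv, mul_one_div, div_le_div_iff₀ hs (by positivity)]; nlinarith
    have h2 : ε / 8 * g ^ 2 * s⁻¹ ≤ ε / 8 * 1 * s⁻¹ := by
      have : g ^ 2 ≤ 1 := by nlinarith
      gcongr
    have h3 : ε / 4 * (1 / 2 * s⁻¹) ≤ ε / 4 * (α * (1 / s ^ 2)) := by gcongr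
    have : 0 ≤ α * (1 / 16 * (g * (b ^ 2 / s ^ 3))) := by positivity
    nlinarith

lemma inv_sq_shift {x s : ℝ} (hx : 0 < x) (hs : 0 < s) (h : s ≤ 2 * x) : 1 / x ^ 2 ≤ 4 * (1 / s ^ 2) := by
  rw [mul_one_div, div_le_div_iff₀ (by positivity) (by positivity)]
  nlinarith

set_option maxHeartbeats 600000 in
lemma claimG {c₀ α N : ℝ} (hc : 1 < c₀) (hα : c₀ ≤ α) (hN : 1 ≤ N) {v : ℤ → ℝ} (hv : RD v) :
    ∑' β, ((1 - c₀⁻¹) / 16384 / N * (phi N β * (Pm v β ^ 2 + (Sv α β)⁻¹ * v β ^ 2)) - 7 * α / N ^ 3 * v β ^ 2) ≤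
      ∑' β, α * (Dv α N β * v β ^ 2 + 2 * (Av α β * (fv N β - fv N (β - 1)) * Pm v β ^ 2)) := by
  have hA := PB_A hc hα
  have hS := PB_S α
  have hSi := PB_Sinv hc hα
  have hf := PB_f hN
  have hD := PB_D hc hα hN
  have kp := kap_pos hc
  have k1 := kap_lt hc
  have hphi : PB (phi N) := PB.of_bdd 1 (fun β => by
    have := abs_nonneg (β : ℝ)
    unfold phi
    rw [abs_of_nonneg (by positivity), div_le_one (by positivity)]
    apply pow_le_pow_left₀ (by linarith) (by linarith))
  have hm : PB (mv α) := PB.of_bdd 1 (fun β => by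
    have := abs_le_Sv α β
    have := Sv_ge hc hα β
    unfold mv
    rw [abs_div, abs_of_nonneg (by positivity : 0 ≤ Sv α β ^ 2), div_le_one (by nlinarith)]
    nlinarith)
  have hSq : PB (fun β => 1 / Sv α β ^ 2) := by
    refine (congrArg PB ?_).mp (hSi.mul hSi)
    ext β; rw [← mul_inv, ← sq, one_div]
  set κ := 1 - c₀⁻¹ with hκ
  obtain ⟨ε, hε⟩ : ∃ ε : ℝ, ε = κ / 2048 := ⟨_, rfl⟩
  have hε0 : 0 < ε := by rw [hε]; positivity
  have hε1 : ε ≤ 1 / 2048 := by rw [hε]; linarith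
  have hεκ : 16 * ε ^ 2 * α / κ = α * ε / 128 := by rw [hε]; field_simp; ring
  have ha : 0 < α := by linarith
  have hK : PB (fun β => 1 / Sv α β ^ 2 + 1 / N ^ 2) := hSq.add (PB.const _)
  apply tsum_le_tel (U := fun β => 1 / N * (ε * α * (mv α β * v (β - 1) ^ 2 + mv α (β - 1) * v β ^ 2)
    + α * ε / 256 * ((1 / Sv α (β - 1) ^ 2 + 1 / N ^ 2) * v β ^ 2 - (1 / Sv α β ^ 2 + 1 / N ^ 2) * v (β - 1) ^ 2)))
  · exact ((hphi.mul_rd (hv.Pm.pow.add (hSi.mul_rd hv.pow))).const_mul _).sub (hv.pow.const_mul _)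
  · exact ((hD.mul_rd hv.pow).add (((hA.mul (hf.sub (hf.shiftm 1))).mul_rd hv.Pm.pow).const_mul _)).const_mul _
  · exact ((((hm.mul_rd (hv.shiftm 1).pow).add ((hm.shiftm 1).mul_rd hv.pow)).const_mul _).add
      ((((hK.shiftm 1).mul_rd hv.pow).sub (hK.mul_rd (hv.shiftm 1).pow)).const_mul _)).const_mul _
  · intro β
    have e1 : β + 1 - 1 = β := by ring
    simp only [e1]
    have u0 := unc_pt hc hα hN hε0 β (Pm v β) (Cm v β)
    rw [← hκ, hεκ] at u0
    have u1 := mv_diff hc hα hN β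
    have u2 := coer_pt hc hα hN hε0 (by linarith) β
    have u3 := Dv_ge hc hα hN β
    obtain ⟨u4, -⟩ := fv_diff hN β
    have a0 := Av_ge hc hα β
    rw [← hκ] at a0
    have s0 := Sv_ge hc hα β
    have sp := Sv_ge hc hα (β + 1)
    have sm := Sv_ge hc hα (β - 1)
    obtain ⟨h1, h2⟩ := Sv_half hc hα β
    have hb := abs_nonneg (β : ℝ)
    have hφ0 : 0 ≤ phi N β := by unfold phi; positivity
    -- Dv bound
    have d1 : Dv α N β ≥ 1 / N * (1 / 8 * (N / (N + |(β : ℝ)|) * ((β : ℝ) ^ 2 / Sv α β ^ 3)) - 6 / N ^ 2) := by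
      refine le_trans (le_of_eq ?_) u3
      have : 0 < Sv α β := by linarith
      field_simp
    have d2 : κ * (1 / (2 * N) * phi N β) ≤ Av α β * (fv N β - fv N (β - 1)) := by
      apply mul_le_mul a0 _ (by positivity) (by linarith)
      refine le_trans (le_of_eq ?_) u4
      unfold phi; field_simp
    have k2 : 1 / Sv α (β + 1) ^ 2 ≤ 4 * (1 / Sv α β ^ 2) := 
      inv_sq_shift (by linarith) (by linarith) h1
    have k3 : 1 / Sv α (β - 1) ^ 2 ≤ 4 * (1 / Sv α β ^ 2) := 
      inv_sq_shift (by linarith) (by linarith) h2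
    have hC : Cm v β ^ 2 ≤ 1 / 2 * (v (β - 1) ^ 2 + v (β + 1) ^ 2) := by
      unfold Cm; nlinarith [sq_nonneg (v (β - 1) + v (β + 1))]
    have hPC : 4 * (ε * α * mv α β) * Pm v β * Cm v β = ε * α * mv α β * (v (β - 1) ^ 2 - v (β + 1) ^ 2) := by
      unfold Cm Pm; ring
    rw [hPC] at u0
    have s2 : 1 / (2 * Sv α β ^ 2) = 1 / 2 * (1 / Sv α β ^ 2) := by
      have : 0 < Sv α β := by linarith
      field_simp
    rw [s2] at u1
    have hQ : 0 ≤ 1 / Sv α β ^ 2 := by positivity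
    have hR : 0 ≤ 1 / N ^ 2 := by positivity
    have hZ : 0 ≤ N / (N + |(β : ℝ)|) * ((β : ℝ) ^ 2 / Sv α β ^ 3) := by
      have := Sv_nonneg α β
      positivity
    have e3 : (1 : ℝ) / (2 * N) = 1 / N * (1 / 2) := by field_simp
    have e4 : 7 * α / N ^ 3 = 1 / N * (7 * α * (1 / N ^ 2)) := by field_simp
    have e5 : 6 / N ^ 2 = 6 * (1 / N ^ 2) := by field_simp
    have e6 : κ / 16384 / N = 1 / N * (ε / 8) := by rw [hε]; field_simp; norm_num
    rw [e4, e6]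
    rw [e3] at d2
    rw [e5] at d1
    have hN1 : 0 < 1 / N := by positivity
    generalize N / (N + |(β : ℝ)|) * ((β : ℝ) ^ 2 / Sv α β ^ 3) = Z at *
    generalize 1 / Sv α β ^ 2 = Q at *
    generalize 1 / Sv α (β + 1) ^ 2 = Qp at *
    generalize 1 / Sv α (β - 1) ^ 2 = Qm at *
    generalize 1 / N ^ 2 = R at *
    generalize 1 / N = i at *
    generalize phi N β = F at *
    generalize Dv α N β = D at *
    generalize Av α β * (fv N β - fv N (β - 1)) = B at *
    generalize (Sv α β)⁻¹ = I at *
    generalize mv α (β + 1) = mp at *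
    generalize mv α (β - 1) = mm at *
    generalize mv α β = m at *
    generalize Pm v β = P at *
    generalize Cm v β = K at *
    generalize v (β - 1) = vm at *
    generalize v (β + 1) = vp at *
    generalize v β = w at *
    -- pieces
    have t1 := mul_le_mul_of_nonneg_right u2 (sq_nonneg w)
    have t2 := mul_le_mul_of_nonneg_left (mul_le_mul_of_nonneg_right u1 (sq_nonneg w)) (by positivity : 0 ≤ ε * α)
    have t3 : α * ε / 128 * (Q + R) * K ^ 2 ≤ α * ε / 128 * (Q + R) * (1 / 2 * (vm ^ 2 + vp ^ 2)) := by gcongr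
    have t4 : α * ε / 256 * ((Qp + R) * w ^ 2 + (Qm + R) * w ^ 2) ≤ α * ε / 256 * ((4 * Q + R) * w ^ 2 + (4 * Q + R) * w ^ 2) := by
      gcongr
    have t5 : α * (D * w ^ 2) ≥ α * (i * (1 / 8 * Z - 6 * R) * w ^ 2) := by gcongr
    have t6 : α * (2 * (κ * (i * (1 / 2) * F) * P ^ 2)) ≤ α * (2 * (B * P ^ 2)) := by gcongr
    have t7 : ε / 8 * F * P ^ 2 ≤ 1 / 2 * α * κ * F * P ^ 2 := by
      have : ε / 8 ≤ 1 / 2 * α * κ := by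
        have : 1 * κ ≤ α * κ := mul_le_mul_of_nonneg_right (by linarith) kp.le
        rw [hε]; linarith
      gcongr
    have t8 : ε * α * (128 * Z) * w ^ 2 ≤ 1 / 16 * α * Z * w ^ 2 := by
      have : ε * α * (128 * Z) ≤ 1 / 16 * α * Z := by
        have := mul_le_mul_of_nonneg_right hε1 (by positivity : 0 ≤ α * Z)
        linarith
      gcongr
    have t9 : (ε * α * 64 + α * ε / 128) * R * w ^ 2 ≤ α * R * w ^ 2 := by
      have : ε * α * 64 + α * ε / 128 ≤ α := by
        have := mul_le_mul_of_nonneg_right hε1 ha.le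
        linarith
      gcongr
    have t10 : 0 ≤ ε * α * Q * w ^ 2 := by positivity
    have main : ε / 8 * (F * (P ^ 2 + I * w ^ 2)) - 7 * α * R * w ^ 2 ≤
       α * ((1 / 8 * Z - 6 * R) * w ^ 2) + α * (κ * F * P ^ 2)
        + (ε * α * (mp * w ^ 2 + m * vp ^ 2) + α * ε / 256 * ((Q + R) * vp ^ 2 - (Qp + R) * w ^ 2)
          - (ε * α * (m * vm ^ 2 + mm * w ^ 2) + α * ε / 256 * ((Qm + R) * w ^ 2 - (Q + R) * vm ^ 2))) := by
      linarith
    have := mul_le_mul_of_nonneg_left main hN1.le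
    linarith


set_option maxHeartbeats 800000 in
lemma scalar_ineq {κ c Ch κ0 q0 r0 s : ℝ} (hκ : 0 < κ) (hκ1 : κ ≤ 1) (hc : 0 < c) (hc1 : c ≤ 1) (hCh : 1 ≤ Ch)
    (hκ0 : 0 < κ0) (hq : 0 < q0) (hr : r0 = κ0 * q0) (hs : 0 < s)
    (g1 : 48 * Ch * (1 + 12 * Ch / κ) ^ 2 * κ0 ≤ c) (g2 : 1152 * q0 ≤ c) (g3 : 18 * q0 ≤ κ * κ0)
    (g4 : 3 * q0 ≤ s) (g5 : s ≤ 1 / 8) (g6 : 128 * s ^ 2 = c * q0)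
    {z τ x p ω F : ℝ} (hz : 0 < z) (hτ : 0 ≤ τ) (hτ1 : τ ≤ 1) (hω : 0 ≤ ω) (hω1 : ω ≤ 1) (hω2 : ω ≤ 2 * z)
    (hF : 1 / (1 + z) ^ 2 ≤ F) :
    -2 * z * x ^ 2 - c / 4 * q0 * τ ^ 3 * F * (p ^ 2 + x ^ 2 / z) + 11 / 2 * q0 * z * x ^ 2
      + 2 * q0 * τ ^ 3 * z * x * p + 3 * q0 * τ ^ 2 * (ω * x * p + x ^ 2)
      - r0 * τ ^ 6 * (2 * κ * z * p ^ 2 + x ^ 2) + 6 * r0 * τ ^ 5 * (p ^ 2 + Ch * x ^ 2 / z)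
    ≤ - s * τ ^ 3 * x ^ 2 := by
  have hr0 : 0 < r0 := by rw [hr]; positivity
  have hF0 : 0 < F := lt_of_lt_of_le (by positivity) hF
  obtain ⟨B, hB⟩ : ∃ B, B = c / 4 * q0 * τ ^ 3 * F + κ * r0 * τ ^ 6 * z := ⟨_, rfl⟩
  have hB1 : 0 ≤ c / 4 * q0 * τ ^ 3 * F := by positivity
  have hB2 : 0 ≤ κ * r0 * τ ^ 6 * z := by positivity
  -- (i)
  have i1 : 12 * Ch * r0 * τ ^ 5 ≤ B := by
    rcases le_total (12 * Ch) (κ * z * τ) with h | h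
    · have := mul_le_mul_of_nonneg_right h (by positivity : 0 ≤ r0 * τ ^ 5)
      rw [hB]; linarith
    · set M := 12 * Ch / κ with hM
      have hM0 : 0 < M := by positivity
      have h1 : z * τ ≤ M := by
        rw [hM, le_div_iff₀ hκ]; linarith
      have h2 : τ ^ 2 / (1 + M) ^ 2 ≤ F := by
        refine le_trans ?_ hF
        rw [div_le_div_iff₀ (by positivity) (by positivity), one_mul, ← mul_pow]
        apply pow_le_pow_left₀ (by positivity)
        linarith
      have h3 : c / 4 * q0 * τ ^ 3 * (τ ^ 2 / (1 + M) ^ 2) ≤ c / 4 * q0 * τ ^ 3 * F := by gcongr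
      have h4 : 12 * Ch * κ0 ≤ c / 4 / (1 + M) ^ 2 := by
        rw [le_div_iff₀ (by positivity)]; linarith
      have h5 := mul_le_mul_of_nonneg_right h4 (by positivity : 0 ≤ q0 * τ ^ 5)
      have e : c / 4 * q0 * τ ^ 3 * (τ ^ 2 / (1 + M) ^ 2) = c / 4 / (1 + M) ^ 2 * (q0 * τ ^ 5) := by
        field_simp
      rw [hB, hr]
      rw [e] at h3
      rw [hr] at hB2
      linarith
  have hB0 : 0 ≤ B := by rw [hB]; linarith
  have hFz : z ≤ 1 → 1 / 4 ≤ F := by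
    intro h
    refine le_trans ?_ hF
    rw [div_le_div_iff₀ (by norm_num) (by positivity)]
    nlinarith
  -- (iii)
  have i3 : 18 * q0 ^ 2 * τ ^ 4 * ω ^ 2 ≤ z * B := by
    rcases le_total z 1 with h | h
    · have hf := hFz h
      have b1 : c / 16 * q0 * τ ^ 3 ≤ B := by
        have : c / 4 * q0 * τ ^ 3 * (1 / 4) ≤ c / 4 * q0 * τ ^ 3 * F := by gcongr
        rw [hB]; linarith
      calc 18 * q0 ^ 2 * τ ^ 4 * ω ^ 2 ≤ 18 * q0 ^ 2 * τ ^ 4 * (2 * z) ^ 2 := by gcongr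
        _ = (72 * q0) * q0 * τ ^ 3 * z * (τ * z) := by ring
        _ ≤ (72 * q0) * q0 * τ ^ 3 * z * 1 := by
            gcongr
            exact mul_le_one₀ hτ1 hz.le h
        _ ≤ (c / 16) * q0 * τ ^ 3 * z * 1 := by gcongr; linarith
        _ = z * (c / 16 * q0 * τ ^ 3) := by ring
        _ ≤ z * B := by gcongr
    · have hω4 : ω ^ 2 ≤ 1 := by nlinarith
      rcases le_total (z * τ) 1 with h' | h'
      · have f1 : 1 / (4 * z ^ 2) ≤ F := by
          refine le_trans ?_ hF
          rw [div_le_div_iff₀ (by positivity) (by positivity)]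
          nlinarith
        have b1 : c / 4 * q0 * τ ^ 3 * (1 / (4 * z ^ 2)) ≤ B := by
          have : c / 4 * q0 * τ ^ 3 * (1 / (4 * z ^ 2)) ≤ c / 4 * q0 * τ ^ 3 * F := by gcongr
          rw [hB]; linarith
        calc 18 * q0 ^ 2 * τ ^ 4 * ω ^ 2 ≤ 18 * q0 ^ 2 * τ ^ 4 * 1 := by gcongr
          _ = (18 * q0) * q0 * τ ^ 3 * τ := by ring
          _ ≤ (c / 16) * q0 * τ ^ 3 * (1 / z) := by
              gcongr
              · linarith
              · rw [le_div_iff₀ hz]; linarith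
          _ = z * (c / 4 * q0 * τ ^ 3 * (1 / (4 * z ^ 2))) := by field_simp; ring
          _ ≤ z * B := by gcongr
      · calc 18 * q0 ^ 2 * τ ^ 4 * ω ^ 2 ≤ 18 * q0 ^ 2 * τ ^ 4 * 1 := by gcongr
          _ = (18 * q0) * q0 * τ ^ 4 * 1 := by ring
          _ ≤ (κ * κ0) * q0 * τ ^ 4 * (z * τ) ^ 2 := by
              gcongr
              exact one_le_pow₀ h'
          _ = z * (κ * r0 * τ ^ 6 * z) := by rw [hr]; ring
          _ ≤ z * B := by gcongr; rw [hB]; linarith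
  -- (iv)
  have i4 : 3 * q0 * τ ^ 2 + s * τ ^ 3 ≤ 1 / 4 * z + 1 / 2 * B / z := by
    have t32 : τ ^ 3 ≤ τ ^ 2 := pow_le_pow_of_le_one hτ hτ1 (by norm_num)
    have t21 : τ ^ 2 ≤ 1 := pow_le_one₀ hτ hτ1
    have l1 : 3 * q0 * τ ^ 2 + s * τ ^ 3 ≤ 2 * s * τ ^ 2 := by
      have := mul_le_mul_of_nonneg_right g4 (sq_nonneg τ)
      have := mul_le_mul_of_nonneg_left t32 hs.le
      linarith
    refine l1.trans ?_
    rcases le_total 1 z with h | h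
    · have : 0 ≤ 1 / 2 * B / z := by positivity
      have := mul_le_mul_of_nonneg_left t21 hs.le
      linarith
    · have hf := hFz h
      have b1 : 8 * s ^ 2 * τ ^ 4 ≤ B := by
        have h1 : c / 4 * q0 * τ ^ 3 * (1 / 4) ≤ c / 4 * q0 * τ ^ 3 * F := by gcongr
        have h2 : τ ^ 4 ≤ τ ^ 3 := pow_le_pow_of_le_one hτ hτ1 (by norm_num)
        have h3 := mul_le_mul_of_nonneg_left h2 (by positivity : 0 ≤ 8 * s ^ 2)
        have h4 : c / 4 * q0 * τ ^ 3 * (1 / 4) = 8 * s ^ 2 * τ ^ 3 := by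
          linear_combination -(1 / 16) * τ ^ 3 * g6
        rw [hB]; linarith
      have e : 1 / 4 * z + 1 / 2 * B / z = (1 / 4 * z ^ 2 + 1 / 2 * B) / z := by field_simp
      rw [e, le_div_iff₀ hz]
      nlinarith [sq_nonneg (z / 2 - 2 * s * τ ^ 2)]
  -- cross terms
  have c1 : 2 * q0 * τ ^ 3 * z * x * p ≤ κ * r0 * τ ^ 6 * z * p ^ 2 + 1 / 2 * z * x ^ 2 := by
    have k0 : 2 * q0 ^ 2 ≤ κ * r0 := by
      have := mul_le_mul_of_nonneg_right g3 hq.le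
      rw [hr]; linear_combination this + 16 * sq_nonneg q0
    have k1 := mul_le_mul_of_nonneg_right k0 (by positivity : 0 ≤ τ ^ 6 * z * p ^ 2)
    have k2 : 0 ≤ z * (2 * q0 * τ ^ 3 * p - x) ^ 2 := by positivity
    linear_combination k1 + 1 / 2 * k2
  have c2 : 3 * q0 * τ ^ 2 * (ω * x * p) ≤ 1 / 2 * B * p ^ 2 + 1 / 4 * z * x ^ 2 := by
    have k1 := mul_le_mul_of_nonneg_right i3 (sq_nonneg p)
    have k2 := sq_nonneg (z * x - 6 * q0 * τ ^ 2 * ω * p)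
    have : z * (3 * q0 * τ ^ 2 * (ω * x * p)) ≤ z * (1 / 2 * B * p ^ 2 + 1 / 4 * z * x ^ 2) := by
      linear_combination 1 / 4 * k2 + 1 / 2 * k1
    exact le_of_mul_le_mul_left this hz
  have p5 : 6 * r0 * τ ^ 5 * p ^ 2 ≤ 1 / 2 * B * p ^ 2 := by
    have : 6 * r0 * τ ^ 5 ≤ 1 / 2 * B := by
      have := mul_le_mul_of_nonneg_right hCh (by positivity : 0 ≤ r0 * τ ^ 5)
      linarith
    gcongr
  have p6 : 6 * r0 * τ ^ 5 * (Ch * x ^ 2 / z) ≤ 1 / 2 * B / z * x ^ 2 := by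
    have e : 6 * r0 * τ ^ 5 * (Ch * x ^ 2 / z) = (6 * Ch * r0 * τ ^ 5) / z * x ^ 2 := by field_simp
    rw [e]
    have h0 : 6 * Ch * r0 * τ ^ 5 ≤ 1 / 2 * B := by linarith
    exact mul_le_mul_of_nonneg_right (div_le_div_of_nonneg_right h0 hz.le) (sq_nonneg x)
  have p7 : B / z * x ^ 2 ≤ c / 4 * q0 * τ ^ 3 * F * (x ^ 2 / z) + r0 * τ ^ 6 * x ^ 2 := by
    have e : B / z * x ^ 2 = c / 4 * q0 * τ ^ 3 * F * (x ^ 2 / z) + κ * (r0 * τ ^ 6 * x ^ 2) := by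
      rw [hB]; field_simp
    have : κ * (r0 * τ ^ 6 * x ^ 2) ≤ 1 * (r0 * τ ^ 6 * x ^ 2) := by gcongr
    linarith
  have p8 : 11 / 2 * q0 * z * x ^ 2 ≤ z * x ^ 2 := by
    have : 11 / 2 * q0 ≤ 1 := by linarith
    have := mul_le_mul_of_nonneg_right this (by positivity : 0 ≤ z * x ^ 2)
    linarith
  have p9 := mul_le_mul_of_nonneg_right i4 (sq_nonneg x)
  have e1 : 1 / 2 * B / z * x ^ 2 = 1 / 2 * (B / z * x ^ 2) := by ring
  have e2 : (1 / 4 * z + 1 / 2 * B / z) * x ^ 2 = 1 / 4 * z * x ^ 2 + 1 / 2 * (B / z * x ^ 2) := by ring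
  have e3 : B * p ^ 2 = c / 4 * q0 * τ ^ 3 * F * p ^ 2 + κ * r0 * τ ^ 6 * z * p ^ 2 := by rw [hB]; ring
  have e4 : Ch * x ^ 2 / z = Ch * (x ^ 2 / z) := by ring
  rw [e1] at p6
  rw [e2] at p9
  linarith

lemma consts {κ : ℝ} (hκ : 0 < κ) (hκ1 : κ ≤ 1) {c Ch : ℝ} (hc : 0 < c) (hc1 : c ≤ 1) (hCh : 1 ≤ Ch) :
    ∃ q0 r0 s : ℝ, 0 < q0 ∧ 0 < r0 ∧ 0 < s ∧ q0 ^ 2 / (4 * r0) + q0 ≤ s * κ / 16 ∧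
    ∀ z τ x p ω F : ℝ, 0 < z → 0 ≤ τ → τ ≤ 1 → 0 ≤ ω → ω ≤ 1 → ω ≤ 2 * z → 1 / (1 + z) ^ 2 ≤ F →
    -2 * z * x ^ 2 - c / 4 * q0 * τ ^ 3 * F * (p ^ 2 + x ^ 2 / z) + 11 / 2 * q0 * z * x ^ 2
      + 2 * q0 * τ ^ 3 * z * x * p + 3 * q0 * τ ^ 2 * (ω * x * p + x ^ 2)
      - r0 * τ ^ 6 * (2 * κ * z * p ^ 2 + x ^ 2) + 6 * r0 * τ ^ 5 * (p ^ 2 + Ch * x ^ 2 / z)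
    ≤ - s * τ ^ 3 * x ^ 2 := by
  obtain ⟨W, hW⟩ : ∃ W, W = 48 * Ch * (1 + 12 * Ch / κ) ^ 2 := ⟨_, rfl⟩
  have hW1 : 1 ≤ W := by
    have : 1 ≤ (1 + 12 * Ch / κ) ^ 2 := one_le_pow₀ (by
      have : 0 < 12 * Ch / κ := by positivity
      linarith)
    rw [hW]; nlinarith
  obtain ⟨k, hk⟩ : ∃ k, k = c / W := ⟨_, rfl⟩
  have hk0 : 0 < k := by rw [hk]; positivity
  have hk1 : k ≤ 1 := by rw [hk, div_le_one (by linarith)]; linarith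
  have hkW : W * k = c := by rw [hk]; field_simp
  obtain ⟨s, hs⟩ : ∃ s, s = c * (κ * k) / 4096 := ⟨_, rfl⟩
  have hs0 : 0 < s := by rw [hs]; positivity
  have hkk : κ * k ≤ 1 := mul_le_one₀ hκ1 hk0.le hk1
  obtain ⟨q, hq⟩ : ∃ q, q = s * (κ * k) / 32 := ⟨_, rfl⟩
  have hq0 : 0 < q := by rw [hq]; positivity
  have hkp : 0 < κ * k := by positivity
  have hsc : s ≤ c / 4096 := by rw [hs]; nlinarith
  have hqs : q ≤ s / 32 := by rw [hq]; nlinarith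
  refine ⟨q, k * q, s, hq0, by positivity, hs0, ?_, ?_⟩
  · have e : q ^ 2 / (4 * (k * q)) = s * κ / 128 := by
      rw [hq]; field_simp; norm_num
    have : q ≤ s * κ / 32 := by
      rw [hq]
      have : s * κ * k ≤ s * κ * 1 := by gcongr
      linarith
    rw [e]
    have : 0 < s * κ := by positivity
    linarith
  · intro z τ x p ω F hz hτ hτ1 hω hω1 hω2 hF
    refine scalar_ineq (κ0 := k) hκ hκ1 hc hc1 hCh hk0 hq0 rfl hs0 ?_ ?_ ?_ ?_ ?_ ?_ hz hτ hτ1 hω hω1 hω2 hF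
    · rw [← hW, hkW]
    · linarith
    · rw [hq]; nlinarith
    · linarith
    · linarith
    · rw [hq]
      rw [hs]; ring


lemma lyap {c₀ α n ν w τ q0 r0 s : ℝ} (hc : 1 < c₀) (hα : c₀ ≤ α) (hn : 1 ≤ n) (hν : ν * n ^ 5 = 1)
    (hw : 1 / 2 ≤ w) (hw1 : w ≤ 1) (hτ : 0 ≤ τ) (hτ1 : τ ≤ 1) (hq : 0 < q0) (hr : 0 < r0)
    (H : ∀ z τ x p ω F : ℝ, 0 < z → 0 ≤ τ → τ ≤ 1 → 0 ≤ ω → ω ≤ 1 → ω ≤ 2 * z → 1 / (1 + z) ^ 2 ≤ F →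
      -2 * z * x ^ 2 - ((1 - c₀⁻¹) / 16384) / 4 * q0 * τ ^ 3 * F * (p ^ 2 + x ^ 2 / z) + 11 / 2 * q0 * z * x ^ 2
      + 2 * q0 * τ ^ 3 * z * x * p + 3 * q0 * τ ^ 2 * (ω * x * p + x ^ 2)
      - r0 * τ ^ 6 * (2 * (1 - c₀⁻¹) * z * p ^ 2 + x ^ 2)
      + 6 * r0 * τ ^ 5 * (p ^ 2 + (3 * (1 - c₀⁻¹)⁻¹) * x ^ 2 / z) ≤ - s * τ ^ 3 * x ^ 2)
    {v : ℤ → ℝ} (hv : RD v) :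
    (∑' β, 2 * (v β * dv α ν (α * w) v β) * (Av α β)⁻¹)
      - q0 * n * τ ^ 3 * (∑' β, fv (n ^ 2) β * (dv α ν (α * w) v β * v (β + 1) + v β * dv α ν (α * w) v (β + 1)))
      - 3 * q0 * τ ^ 2 / n ^ 2 * (∑' β, fv (n ^ 2) β * (v β * v (β + 1)))
      + r0 * n ^ 2 * τ ^ 6 * (∑' β, (2 * (v β * dv α ν (α * w) v β) * (Av α β)⁻¹
          - Av α β * (2 * (Cm v β * Cm (dv α ν (α * w) v) β))))
      + 6 * r0 * τ ^ 5 / n * (∑' β, (v β ^ 2 * (Av α β)⁻¹ - Av α β * Cm v β ^ 2))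
      ≤ - s * τ ^ 3 / n ^ 3 * ∑' β, v β ^ 2 := by
  have hn0 : 0 < n := by linarith
  have hN : 1 ≤ n ^ 2 := one_le_pow₀ hn
  have hν0 : 0 < ν := by
    have : 0 < n ^ 5 := by positivity
    by_contra h
    nlinarith
  have hκ := kap_pos hc
  set κ := 1 - c₀⁻¹ with hκd
  have hφ : PB (phi (n ^ 2)) := by
    refine PB.of_bdd 1 (fun β => ?_)
    unfold phi
    rw [abs_of_nonneg (by positivity), div_le_one (by positivity)]
    have := abs_nonneg (β : ℝ)
    exact pow_le_pow_left₀ (by positivity) (by linarith) 2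
  have hω : PB (fun β => min 1 (2 * Sv α β / n ^ 2)) := by
    refine PB.of_bdd 1 (fun β => ?_)
    have := Sv_nonneg α β
    rw [abs_of_nonneg (le_min zero_le_one (by positivity))]
    exact min_le_left _ _
  have S0 := Sv_nonneg α
  obtain ⟨X1, H1⟩ := ((PB_S α).mul_rd hv.pow).summable
  obtain ⟨X2, H2⟩ := (hφ.mul_rd (hv.Pm.pow.add ((PB_Sinv hc hα).mul_rd hv.pow))).summable
  obtain ⟨X3, H3⟩ := hv.pow.summable
  obtain ⟨X4, H4⟩ := ((PB_S α).mul_rd (hv.abs.mul hv.Pm.abs)).summable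
  obtain ⟨X5, H5⟩ := (hω.mul_rd (hv.abs.mul hv.Pm.abs)).summable
  obtain ⟨X6, H6⟩ := ((PB_S α).mul_rd hv.Pm.pow).summable
  obtain ⟨X7, H7⟩ := hv.Pm.pow.summable
  obtain ⟨X8, H8⟩ := ((PB_Sinv hc hα).mul_rd hv.pow).summable
  have X1n : 0 ≤ X1 := H1.nonneg (fun β => mul_nonneg (S0 β) (sq_nonneg _))
  have X3n : 0 ≤ X3 := H3.nonneg (fun β => (sq_nonneg _))
  have X2n : 0 ≤ X2 := H2.nonneg (fun β => by
    have := S0 β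
    unfold phi; positivity)
  have X31 : α * X3 ≤ X1 := hasSum_le (fun β =>
    mul_le_mul_of_nonneg_right (le_Sv (by linarith) β) (sq_nonneg _)) (H3.mul_left α) H1
  -- pieces
  have pe : (∑' β, 2 * (v β * dv α ν (α * w) v β) * (Av α β)⁻¹) ≤ -2 * ν * X1 := by
    rw [sum_e hc hα ν _ hv]
    have : X1 ≤ ∑' β, Sv α β * v β ^ 2 * (Av α β)⁻¹ := by
      refine hasSum_le (fun β => ?_) H1 (((PB_S α).mul_rd hv.pow).mul_pb (PB_Ainv hc hα)).summable.hasSum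
      have h1 : 1 ≤ (Av α β)⁻¹ := (one_le_inv₀ (Av_pos hc hα β)).mpr (Av_le hc hα β)
      exact le_mul_of_one_le_right (mul_nonneg (S0 β) (sq_nonneg _)) h1
    nlinarith
  have pV : κ / 16384 / n ^ 2 / 4 * X2 - 7 / 2 / n ^ 6 * X1 - ν * (2 * X4 + 2 / n ^ 2 * X1) ≤
      ∑' β, fv (n ^ 2) β * (dv α ν (α * w) v β * v (β + 1) + v β * dv α ν (α * w) v (β + 1)) := by
    rw [virial hc hα hN ν _ hv]
    have hT := T_bound hc hα hN hv
    have hG := claimG hc hα hN hv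
    rw [(((H4.mul_left 2)).add (H1.mul_left (2 / n ^ 2))).tsum_eq] at hT
    have e1 : ∑' β, ((1 - c₀⁻¹) / 16384 / n ^ 2 * (phi (n ^ 2) β * (Pm v β ^ 2 + (Sv α β)⁻¹ * v β ^ 2))
        - 7 * α / (n ^ 2) ^ 3 * v β ^ 2) = κ / 16384 / n ^ 2 * X2 - 7 * α / (n ^ 2) ^ 3 * X3 :=
      ((H2.mul_left _).sub (H3.mul_left _)).tsum_eq
    rw [e1] at hG
    have hGs : Summable (fun β => α * (Dv α (n ^ 2) β * v β ^ 2 + 2 * (Av α β * (fv (n ^ 2) β - fv (n ^ 2) (β - 1)) * Pm v β ^ 2))) :=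
      ((((PB_D hc hα hN).mul_rd hv.pow).add ((((PB_A hc hα).mul ((PB_f hN).sub ((PB_f hN).shiftm 1))).mul_rd hv.Pm.pow).const_mul 2)).const_mul α).summable
    have hTs : Summable (fun β => fv (n ^ 2) β * (Sv α β + Sv α (β + 1)) * (v β * v (β + 1))) :=
      (((PB_f hN).mul ((PB_S α).add ((PB_S α).shift 1))).mul_rd (hv.mul (hv.shift 1))).summable
    obtain ⟨G, HG⟩ := hGs
    obtain ⟨T, HT⟩ := hTs
    rw [HG.tsum_eq] at hG
    rw [HT.tsum_eq] at hT
    have e2 : ∑' β, (α * w / 2 * (Dv α (n ^ 2) β * v β ^ 2 + 2 * (Av α β * (fv (n ^ 2) β - fv (n ^ 2) (β - 1)) * Pm v β ^ 2))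
        - ν * (fv (n ^ 2) β * (Sv α β + Sv α (β + 1)) * (v β * v (β + 1)))) = w / 2 * G - ν * T := by
      rw [← ((HG.mul_left (w / 2)).sub (HT.mul_left ν)).tsum_eq]
      congr 1; ext β; ring
    rw [e2]
    have a1 := mul_le_mul_of_nonneg_left hG (by linarith : 0 ≤ w / 2)
    have a2 := mul_le_mul_of_nonneg_left hT hν0.le
    have a3 : 1 / 4 * (κ / 16384 / n ^ 2 * X2) ≤ w / 2 * (κ / 16384 / n ^ 2 * X2) :=
      mul_le_mul_of_nonneg_right (by linarith) (by positivity)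
    have a4 : w / 2 * (7 / n ^ 6 * (α * X3)) ≤ 1 / 2 * (7 / n ^ 6 * X1) := by
      have : 0 < α := by linarith
      gcongr
    have a5 : 7 * α / (n ^ 2) ^ 3 * X3 = 7 / n ^ 6 * (α * X3) := by field_simp
    rw [a5] at a1
    have a6 : κ / 16384 / n ^ 2 / 4 * X2 = 1 / 4 * (κ / 16384 / n ^ 2 * X2) := by ring
    have a7 : 7 / 2 / n ^ 6 * X1 = 1 / 2 * (7 / n ^ 6 * X1) := by ring
    rw [a6, a7]
    linarith
  have pVb : - (X5 + 1 / n ^ 2 * X3) ≤ ∑' β, fv (n ^ 2) β * (v β * v (β + 1)) := by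
    have := V_bound hc hα hN hv (-1) (by norm_num)
    rw [(H5.add (H3.mul_left (1 / n ^ 2))).tsum_eq] at this
    linarith
  have ph := sum_h hc hα hν0.le (α * w) hv
  have ph2 : 2 * κ * X6 + X3 ≤ ∑' β, (2 * (Av α β * Sv α β * Pm v β ^ 2) + v β ^ 2) := by
    refine hasSum_le (fun β => ?_) ((H6.mul_left (2 * κ)).add H3)
      (((((PB_A hc hα).mul (PB_S α)).mul_rd hv.Pm.pow).const_mul 2).add hv.pow).summable.hasSum
    have := mul_le_mul_of_nonneg_right (Av_ge hc hα β) (mul_nonneg (S0 β) (sq_nonneg (Pm v β)))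
    linarith
  have ph3 := h_upper hc hα hv
  rw [(H7.add (H8.mul_left (3 * (1 - c₀⁻¹)⁻¹))).tsum_eq] at ph3
  -- pointwise
  have main : (-2 / n ^ 2 * X1) - κ / 16384 / 4 * q0 * τ ^ 3 * n ^ 2 * X2 + 11 / 2 * q0 / n ^ 2 * X1
      + 2 * q0 * τ ^ 3 / n * X4 + 3 * q0 * τ ^ 2 * (n * X5 + X3)
      - r0 * τ ^ 6 * (2 * κ * X6 + X3) + 6 * r0 * τ ^ 5 * n ^ 2 * (X7 + 3 * κ⁻¹ * X8) ≤ - s * τ ^ 3 * X3 := by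
    refine hasSum_le (fun β => ?_) (((((((H1.mul_left (-2 / n ^ 2)).sub
      (H2.mul_left (κ / 16384 / 4 * q0 * τ ^ 3 * n ^ 2))).add (H1.mul_left (11 / 2 * q0 / n ^ 2))).add
      (H4.mul_left (2 * q0 * τ ^ 3 / n))).add (((H5.mul_left n).add H3).mul_left (3 * q0 * τ ^ 2))).sub
      (((H6.mul_left (2 * κ)).add H3).mul_left (r0 * τ ^ 6))).add
      ((H7.add (H8.mul_left (3 * κ⁻¹))).mul_left (6 * r0 * τ ^ 5 * n ^ 2))) (H3.mul_left (- s * τ ^ 3))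
    have hs : 0 < Sv α β := by have := Sv_ge hc hα β; linarith
    have hF : 1 / (1 + Sv α β / n ^ 2) ^ 2 ≤ phi (n ^ 2) β := by
      unfold phi
      have e : 1 / (1 + Sv α β / n ^ 2) ^ 2 = (n ^ 2) ^ 2 / (n ^ 2 + Sv α β) ^ 2 := by
        field_simp
      rw [e]
      have := abs_le_Sv α β
      gcongr
    have := H (Sv α β / n ^ 2) τ (|v β|) (n * |Pm v β|) (min 1 (2 * Sv α β / n ^ 2)) (phi (n ^ 2) β)
      (by positivity) hτ hτ1 (le_min zero_le_one (by positivity)) (min_le_left _ _)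
      ((min_le_right _ _).trans (by rw [mul_div_assoc])) hF
    rw [mul_pow, sq_abs, sq_abs] at this
    refine le_of_eq_of_le ?_ this
    field_simp
  -- combine
  have b1 := mul_le_mul_of_nonneg_left pV (by positivity : 0 ≤ q0 * n * τ ^ 3)
  have b2 := mul_le_mul_of_nonneg_left pVb (by positivity : 0 ≤ 3 * q0 * τ ^ 2 / n ^ 2)
  have b3 := mul_le_mul_of_nonneg_left (ph.trans (mul_le_mul_of_nonpos_left ph2 (by linarith : -ν ≤ 0)))
    (by positivity : 0 ≤ r0 * n ^ 2 * τ ^ 6)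
  have b4 := mul_le_mul_of_nonneg_left ph3 (by positivity : 0 ≤ 6 * r0 * τ ^ 5 / n)
  have b5 := mul_le_mul_of_nonneg_left main (by positivity : 0 ≤ 1 / n ^ 3)
  have hν' : ν = 1 / n ^ 5 := by field_simp; linarith
  have t3 : τ ^ 3 ≤ 1 := pow_le_one₀ hτ hτ1
  have b6 : q0 * (7 / 2 / n ^ 5) * X1 * τ ^ 3 ≤ q0 * (7 / 2 / n ^ 5) * X1 * 1 := by gcongr
  have b7 : 2 * q0 / n ^ 5 * X1 * (τ ^ 3 * (1 / n)) ≤ 2 * q0 / n ^ 5 * X1 * 1 := by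
    have : τ ^ 3 * (1 / n) ≤ 1 * 1 := by
      apply mul_le_mul t3 _ (by positivity) zero_le_one
      rw [div_le_one hn0]; exact hn
    have := mul_le_mul_of_nonneg_left this (by positivity : 0 ≤ 2 * q0 / n ^ 5 * X1)
    linarith
  have b8 : 3 * q0 * τ ^ 2 / n ^ 3 * X3 * (1 / n) ≤ 3 * q0 * τ ^ 2 / n ^ 3 * X3 * 1 := by
    gcongr
    rw [div_le_one hn0]; exact hn
  rw [H3.tsum_eq]
  subst hν'
  generalize (∑' β, 2 * (v β * dv α (1 / n ^ 5) (α * w) v β) * (Av α β)⁻¹) = Y1 at *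
  generalize (∑' β, fv (n ^ 2) β * (dv α (1 / n ^ 5) (α * w) v β * v (β + 1) + v β * dv α (1 / n ^ 5) (α * w) v (β + 1))) = Y2 at *
  generalize (∑' β, fv (n ^ 2) β * (v β * v (β + 1))) = Y3 at *
  generalize (∑' β, (2 * (v β * dv α (1 / n ^ 5) (α * w) v β) * (Av α β)⁻¹
          - Av α β * (2 * (Cm v β * Cm (dv α (1 / n ^ 5) (α * w) v) β)))) = Y4 at *
  generalize (∑' β, (v β ^ 2 * (Av α β)⁻¹ - Av α β * Cm v β ^ 2)) = Y5 at *
  have key : -2 * (1 / n ^ 5) * X1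
      - q0 * n * τ ^ 3 * (κ / 16384 / n ^ 2 / 4 * X2 - 7 / 2 / n ^ 6 * X1 - 1 / n ^ 5 * (2 * X4 + 2 / n ^ 2 * X1))
      - 3 * q0 * τ ^ 2 / n ^ 2 * (-(X5 + 1 / n ^ 2 * X3))
      + r0 * n ^ 2 * τ ^ 6 * (-(1 / n ^ 5) * (2 * κ * X6 + X3))
      + 6 * r0 * τ ^ 5 / n * (X7 + 3 * κ⁻¹ * X8)
      = 1 / n ^ 3 * ((-2 / n ^ 2 * X1) - κ / 16384 / 4 * q0 * τ ^ 3 * n ^ 2 * X2 + 11 / 2 * q0 / n ^ 2 * X1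
      + 2 * q0 * τ ^ 3 / n * X4 + 3 * q0 * τ ^ 2 * (n * X5 + X3)
      - r0 * τ ^ 6 * (2 * κ * X6 + X3) + 6 * r0 * τ ^ 5 * n ^ 2 * (X7 + 3 * κ⁻¹ * X8))
      + (q0 * (7 / 2 / n ^ 5) * X1 * τ ^ 3 - q0 * (7 / 2 / n ^ 5) * X1 * 1)
      + (2 * q0 / n ^ 5 * X1 * (τ ^ 3 * (1 / n)) - 2 * q0 / n ^ 5 * X1 * 1)
      + (3 * q0 * τ ^ 2 / n ^ 3 * X3 * (1 / n) - 3 * q0 * τ ^ 2 / n ^ 3 * X3 * 1) := by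
    field_simp
    ring
  have e9 : - s * τ ^ 3 / n ^ 3 * X3 = 1 / n ^ 3 * (- s * τ ^ 3 * X3) := by ring
  rw [e9]
  linarith


/-- Dominated families on `[0,T]`. -/
def UD (T : ℝ) (v : ℝ → ℤ → ℝ) : Prop :=
  ∃ V : ℤ → ℝ, RD V ∧ ∀ t ∈ Set.Icc 0 T, ∀ β, |v t β| ≤ V β

lemma RD.of_le {u V : ℤ → ℝ} (hV : RD V) (h : ∀ β, |u β| ≤ V β) : RD u := by
  intro k
  obtain ⟨C, hC⟩ := hV k
  refine ⟨C, fun β => le_trans ?_ (hC β)⟩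
  exact mul_le_mul_of_nonneg_left ((h β).trans (le_abs_self _)) (by positivity)

lemma UD.rd {T : ℝ} {v : ℝ → ℤ → ℝ} (h : UD T v) {t : ℝ} (ht : t ∈ Set.Icc 0 T) : RD (v t) := by
  obtain ⟨V, hV, h⟩ := h
  exact hV.of_le (h t ht)

lemma UD.mul {T : ℝ} {u v : ℝ → ℤ → ℝ} (hu : UD T u) (hv : UD T v) : UD T (fun t β => u t β * v t β) := by
  obtain ⟨U, hU, hu⟩ := hu
  obtain ⟨V, hV, hv⟩ := hv
  refine ⟨fun β => U β * V β, hU.mul hV, fun t ht β => ?_⟩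
  rw [abs_mul]
  exact mul_le_mul (hu t ht β) (hv t ht β) (abs_nonneg _) ((abs_nonneg _).trans (hu t ht β))

lemma UD.add {T : ℝ} {u v : ℝ → ℤ → ℝ} (hu : UD T u) (hv : UD T v) : UD T (fun t β => u t β + v t β) := by
  obtain ⟨U, hU, hu⟩ := hu
  obtain ⟨V, hV, hv⟩ := hv
  exact ⟨fun β => U β + V β, hU.add hV, fun t ht β =>
    (abs_add_le _ _).trans (add_le_add (hu t ht β) (hv t ht β))⟩

lemma UD.sub {T : ℝ} {u v : ℝ → ℤ → ℝ} (hu : UD T u) (hv : UD T v) : UD T (fun t β => u t β - v t β) := by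
  obtain ⟨U, hU, hu⟩ := hu
  obtain ⟨V, hV, hv⟩ := hv
  exact ⟨fun β => U β + V β, hU.add hV, fun t ht β =>
    (abs_sub _ _).trans (add_le_add (hu t ht β) (hv t ht β))⟩

lemma PB.abs {c : ℤ → ℝ} (hc : PB c) : PB (fun β => |c β|) := by
  obtain ⟨k, C, h⟩ := hc
  exact ⟨k, C, fun β => by simpa using h β⟩

lemma UD.pb {T : ℝ} {c : ℤ → ℝ} (hc : PB c) {v : ℝ → ℤ → ℝ} (hv : UD T v) : UD T (fun t β => c β * v t β) := by
  obtain ⟨V, hV, hv⟩ := hv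
  refine ⟨fun β => |c β| * V β, hc.abs.mul_rd hV, fun t ht β => ?_⟩
  rw [abs_mul]
  exact mul_le_mul_of_nonneg_left (hv t ht β) (abs_nonneg _)

lemma UD.bt {T K : ℝ} {a : ℝ → ℝ} (ha : ∀ t ∈ Set.Icc 0 T, |a t| ≤ K) {v : ℝ → ℤ → ℝ} (hv : UD T v) :
    UD T (fun t β => a t * v t β) := by
  obtain ⟨V, hV, hv⟩ := hv
  refine ⟨fun β => K * V β, hV.const_mul K, fun t ht β => ?_⟩
  rw [abs_mul]
  exact mul_le_mul (ha t ht) (hv t ht β) (abs_nonneg _) ((abs_nonneg _).trans (ha t ht))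

lemma UD.shift {T : ℝ} {v : ℝ → ℤ → ℝ} (hv : UD T v) (j : ℤ) : UD T (fun t β => v t (β + j)) := by
  obtain ⟨V, hV, hv⟩ := hv
  exact ⟨_, hV.shift j, fun t ht β => hv t ht _⟩

lemma UD.shiftm {T : ℝ} {v : ℝ → ℤ → ℝ} (hv : UD T v) (j : ℤ) : UD T (fun t β => v t (β - j)) := by
  obtain ⟨V, hV, hv⟩ := hv
  exact ⟨_, hV.shiftm j, fun t ht β => hv t ht _⟩

lemma UD.Cm {T : ℝ} {v : ℝ → ℤ → ℝ} (hv : UD T v) : UD T (fun t β => Cm (v t) β) := by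
  have := UD.pb (PB.const (1 / 2)) ((hv.shiftm 1).sub (hv.shift 1))
  unfold _root_.Cm
  convert this using 3
  ring

lemma UD.dv {T c₀ α ν : ℝ} (hc : 1 < c₀) (hα : c₀ ≤ α) (hν : 0 ≤ ν) {v : ℝ → ℤ → ℝ} (hv : UD T v) :
    UD T (fun t β => dv α ν (α * Real.exp (-(ν * t))) (v t) β) := by
  have ha : ∀ t ∈ Set.Icc 0 T, |α * Real.exp (-(ν * t))| ≤ |α| := fun t ht => by
    rw [abs_mul, abs_of_pos (Real.exp_pos _)]
    have : Real.exp (-(ν * t)) ≤ 1 := Real.exp_le_one_iff.mpr (by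
      have := mul_nonneg hν ht.1
      linarith)
    exact mul_le_of_le_one_right (abs_nonneg _) this
  exact (UD.pb (PB.const (-ν)) (UD.pb (PB_S α) hv)).add (UD.bt ha (UD.pb (PB_A hc hα) hv.Cm))

lemma tsum_hasDerivAt {T : ℝ} {g g' : ℝ → ℤ → ℝ} (hg : UD T g) (hg' : UD T g')
    (hd : ∀ t β, HasDerivAt (fun s => g s β) (g' t β) t) {t : ℝ} (ht : t ∈ Set.Ioo 0 T) :
    HasDerivAt (fun s => ∑' β, g s β) (∑' β, g' t β) t := by
  obtain ⟨V, hV, hb⟩ := hg'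
  exact hasDerivAt_tsum_of_isPreconnected (g := fun β s => g s β) (g' := fun β s => g' s β)
    hV.summable isOpen_Ioo isPreconnected_Ioo (fun β y _ => hd y β)
    (fun β y hy => by rw [Real.norm_eq_abs]; exact hb y (Set.Ioo_subset_Icc_self hy) β)
    ht (hg.rd (Set.Ioo_subset_Icc_self ht)).summable ht

lemma tsum_contOn {T : ℝ} {g g' : ℝ → ℤ → ℝ} (hg : UD T g)
    (hd : ∀ t β, HasDerivAt (fun s => g s β) (g' t β) t) :
    ContinuousOn (fun s => ∑' β, g s β) (Set.Icc 0 T) := by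
  obtain ⟨V, hV, hb⟩ := hg
  exact continuousOn_tsum (fun β t _ => (hd t β).continuousAt.continuousWithinAt) hV.summable
    (fun β y hy => by rw [Real.norm_eq_abs]; exact hb y hy β)

noncomputable def ef (α : ℝ) (v : ℤ → ℝ) : ℝ := ∑' β, v β ^ 2 * (Av α β)⁻¹
noncomputable def hf (α : ℝ) (v : ℤ → ℝ) : ℝ := ∑' β, (v β ^ 2 * (Av α β)⁻¹ - Av α β * Cm v β ^ 2)
noncomputable def Vf (N : ℝ) (v : ℤ → ℝ) : ℝ := ∑' β, fv N β * (v β * v (β + 1))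

/-- Real solution of the gauged system. -/
def Sol (α ν : ℝ) (v : ℝ → ℤ → ℝ) : Prop :=
  ∀ t β, HasDerivAt (fun s => v s β) (dv α ν (α * Real.exp (-(ν * t))) (v t) β) t

lemma ef_deriv {T c₀ α ν : ℝ} (hc : 1 < c₀) (hα : c₀ ≤ α) (hν : 0 ≤ ν) {v : ℝ → ℤ → ℝ} (hv : UD T v) (hs : Sol α ν v) : ContinuousOn (fun t => ef α (v t)) (Set.Icc 0 T) ∧ ∀ t ∈ Set.Ioo 0 T,
    HasDerivAt (fun t => ef α (v t))
      (∑' β, 2 * (v t β * dv α ν (α * Real.exp (-(ν * t))) (v t) β) * (Av α β)⁻¹) t := by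
  have hd : ∀ t β, HasDerivAt (fun s => v s β ^ 2 * (Av α β)⁻¹)
      (2 * (v t β * dv α ν (α * Real.exp (-(ν * t))) (v t) β) * (Av α β)⁻¹) t := fun t β => by
    refine (((hs t β).pow 2).mul_const _).congr_deriv ?_
    push_cast; ring
  have g1 : UD T (fun t β => v t β ^ 2 * (Av α β)⁻¹) := by
    have := UD.pb (PB_Ainv hc hα) (hv.mul hv)
    convert this using 3; ring
  have g2 : UD T (fun t β => 2 * (v t β * dv α ν (α * Real.exp (-(ν * t))) (v t) β) * (Av α β)⁻¹) := by
    have := UD.pb (PB.const 2) (UD.pb (PB_Ainv hc hα) (hv.mul (hv.dv hc hα hν)))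
    convert this using 3; ring
  exact ⟨tsum_contOn g1 hd, fun t ht => tsum_hasDerivAt g1 g2 hd ht⟩

lemma hf_deriv {T c₀ α ν : ℝ} (hc : 1 < c₀) (hα : c₀ ≤ α) (hν : 0 ≤ ν) {v : ℝ → ℤ → ℝ} (hv : UD T v) (hs : Sol α ν v) : ContinuousOn (fun t => hf α (v t)) (Set.Icc 0 T) ∧ ∀ t ∈ Set.Ioo 0 T,
    HasDerivAt (fun t => hf α (v t))
      (∑' β, (2 * (v t β * dv α ν (α * Real.exp (-(ν * t))) (v t) β) * (Av α β)⁻¹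
        - Av α β * (2 * (Cm (v t) β * Cm (dv α ν (α * Real.exp (-(ν * t))) (v t)) β)))) t := by
  have hC : ∀ t β, HasDerivAt (fun s => Cm (v s) β) (Cm (dv α ν (α * Real.exp (-(ν * t))) (v t)) β) t :=
    fun t β => ((hs t (β - 1)).sub (hs t (β + 1))).div_const 2
  have hd : ∀ t β, HasDerivAt (fun s => v s β ^ 2 * (Av α β)⁻¹ - Av α β * Cm (v s) β ^ 2)
      (2 * (v t β * dv α ν (α * Real.exp (-(ν * t))) (v t) β) * (Av α β)⁻¹
        - Av α β * (2 * (Cm (v t) β * Cm (dv α ν (α * Real.exp (-(ν * t))) (v t)) β))) t := fun t β => by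
    refine ((((hs t β).pow 2).mul_const _).sub (((hC t β).pow 2).const_mul _)).congr_deriv ?_
    push_cast; ring
  have g1 : UD T (fun t β => v t β ^ 2 * (Av α β)⁻¹ - Av α β * Cm (v t) β ^ 2) := by
    have := (UD.pb (PB_Ainv hc hα) (hv.mul hv)).sub (UD.pb (PB_A hc hα) (hv.Cm.mul hv.Cm))
    convert this using 3; ring
  have g2 : UD T (fun t β => 2 * (v t β * dv α ν (α * Real.exp (-(ν * t))) (v t) β) * (Av α β)⁻¹
        - Av α β * (2 * (Cm (v t) β * Cm (dv α ν (α * Real.exp (-(ν * t))) (v t)) β))) := by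
    have := UD.pb (PB.const 2) ((UD.pb (PB_Ainv hc hα) (hv.mul (hv.dv hc hα hν))).sub
      (UD.pb (PB_A hc hα) (hv.Cm.mul (hv.dv hc hα hν).Cm)))
    convert this using 3; ring
  exact ⟨tsum_contOn g1 hd, fun t ht => tsum_hasDerivAt g1 g2 hd ht⟩

lemma Vf_deriv {T c₀ α ν : ℝ} (hc : 1 < c₀) (hα : c₀ ≤ α) (hν : 0 ≤ ν) {v : ℝ → ℤ → ℝ} (hv : UD T v) (hs : Sol α ν v) {N : ℝ} (hN : 1 ≤ N) : ContinuousOn (fun t => Vf N (v t)) (Set.Icc 0 T) ∧ ∀ t ∈ Set.Ioo 0 T,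
    HasDerivAt (fun t => Vf N (v t))
      (∑' β, fv N β * (dv α ν (α * Real.exp (-(ν * t))) (v t) β * v t (β + 1)
        + v t β * dv α ν (α * Real.exp (-(ν * t))) (v t) (β + 1))) t := by
  have hd : ∀ t β, HasDerivAt (fun s => fv N β * (v s β * v s (β + 1)))
      (fv N β * (dv α ν (α * Real.exp (-(ν * t))) (v t) β * v t (β + 1)
        + v t β * dv α ν (α * Real.exp (-(ν * t))) (v t) (β + 1))) t := fun t β =>
    ((hs t β).mul (hs t (β + 1))).const_mul _
  have g1 : UD T (fun t β => fv N β * (v t β * v t (β + 1))) := UD.pb (PB_f hN) (hv.mul (hv.shift 1))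
  have g2 : UD T (fun t β => fv N β * (dv α ν (α * Real.exp (-(ν * t))) (v t) β * v t (β + 1)
        + v t β * dv α ν (α * Real.exp (-(ν * t))) (v t) (β + 1))) :=
    UD.pb (PB_f hN) (((hv.dv hc hα hν).mul (hv.shift 1)).add (hv.mul ((hv.dv hc hα hν).shift 1)))
  exact ⟨tsum_contOn g1 hd, fun t ht => tsum_hasDerivAt g1 g2 hd ht⟩

lemma ef_anti {T c₀ α ν : ℝ} (hc : 1 < c₀) (hα : c₀ ≤ α) (hν : 0 ≤ ν) {v : ℝ → ℤ → ℝ} (hv : UD T v) (hs : Sol α ν v) : AntitoneOn (fun t => ef α (v t)) (Set.Icc 0 T) := by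
  obtain ⟨h1, h2⟩ := ef_deriv hc hα hν hv hs
  apply antitoneOn_of_deriv_nonpos (convex_Icc 0 T) h1
  · rw [interior_Icc]
    exact fun t ht => (h2 t ht).differentiableAt.differentiableWithinAt
  · rw [interior_Icc]
    intro t ht
    rw [(h2 t ht).deriv, sum_e hc hα ν _ (hv.rd (Set.Ioo_subset_Icc_self ht))]
    have : 0 ≤ ∑' β, Sv α β * v t β ^ 2 * (Av α β)⁻¹ := tsum_nonneg (fun β =>
      mul_nonneg (mul_nonneg (Sv_nonneg α β) (sq_nonneg _)) (inv_pos.mpr (Av_pos hc hα β)).le)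
    nlinarith [mul_nonneg hν this]



lemma ef_upper {c₀ α : ℝ} (hc : 1 < c₀) (hα : c₀ ≤ α) {v : ℤ → ℝ} (hv : RD v) :
    (1 - c₀⁻¹) * ef α v ≤ ∑' β, v β ^ 2 := by
  unfold ef
  refine hasSum_le (fun β => ?_) ((hv.pow.mul_pb (PB_Ainv hc hα)).summable.hasSum.mul_left _) hv.pow.summable.hasSum
  have h := Av_pos hc hα β
  have h1 : (1 - c₀⁻¹) * (Av α β)⁻¹ ≤ 1 := by
    rw [← div_eq_mul_inv, div_le_one h]; exact Av_ge hc hα β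
  have := mul_le_mul_of_nonneg_left h1 (sq_nonneg (v β))
  linarith

lemma ef_lower {c₀ α : ℝ} (hc : 1 < c₀) (hα : c₀ ≤ α) {v : ℤ → ℝ} (hv : RD v) :
    ∑' β, v β ^ 2 ≤ ef α v := by
  unfold ef
  refine hasSum_le (fun β => ?_) hv.pow.summable.hasSum (hv.pow.mul_pb (PB_Ainv hc hα)).summable.hasSum
  have h1 : 1 ≤ (Av α β)⁻¹ := (one_le_inv₀ (Av_pos hc hα β)).mpr (Av_le hc hα β)
  exact le_mul_of_one_le_right (sq_nonneg _) h1

lemma end_bound {c₀ α n q0 r0 : ℝ} (hc : 1 < c₀) (hα : c₀ ≤ α) (hn : 1 ≤ n) (hq : 0 < q0) (hr : 0 < r0)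
    {v : ℤ → ℝ} (hv : RD v) :
    q0 * n * Vf (n ^ 2) v ≤ r0 * n ^ 2 * hf α v + (q0 ^ 2 / (4 * r0) + q0) * ef α v := by
  have hN : 1 ≤ n ^ 2 := one_le_pow₀ hn
  have hn0 : 0 < n := by linarith
  have h1 := V_bound hc hα hN hv 1 (by norm_num)
  have h2 := h_lower hc hα hv
  have h3 := ef_lower hc hα hv
  obtain ⟨X3, H3⟩ := hv.pow.summable
  obtain ⟨X4, H4⟩ := (hv.abs.mul hv.Pm.abs).summable
  obtain ⟨X7, H7⟩ := hv.Pm.pow.summable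
  have hω : PB (fun β => min 1 (2 * Sv α β / n ^ 2)) := by
    refine PB.of_bdd 1 (fun β => ?_)
    have := Sv_nonneg α β
    rw [abs_of_nonneg (le_min zero_le_one (by positivity))]
    exact min_le_left _ _
  have h4 : ∑' β, (min 1 (2 * Sv α β / n ^ 2) * (|v β| * |Pm v β|) + 1 / n ^ 2 * v β ^ 2) ≤ X4 + 1 / n ^ 2 * X3 := by
    refine hasSum_le (fun β => ?_) ((hω.mul_rd (hv.abs.mul hv.Pm.abs)).add (hv.pow.const_mul _)).summable.hasSum
      (H4.add (H3.mul_left (1 / n ^ 2)))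
    have := mul_le_mul_of_nonneg_right (min_le_left 1 (2 * Sv α β / n ^ 2)) (by positivity : 0 ≤ |v β| * |Pm v β|)
    linarith
  have h5 : q0 * n * X4 ≤ r0 * n ^ 2 * X7 + q0 ^ 2 / (4 * r0) * X3 := by
    refine hasSum_le (fun β => ?_) (H4.mul_left _) ((H7.mul_left _).add (H3.mul_left _))
    rw [← sq_abs (Pm v β), ← sq_abs (v β)]
    have k := sq_nonneg (2 * r0 * n * |Pm v β| - q0 * |v β|)
    have e : r0 * n ^ 2 * |Pm v β| ^ 2 + q0 ^ 2 / (4 * r0) * |v β| ^ 2 - q0 * n * (|v β| * |Pm v β|)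
      = (2 * r0 * n * |Pm v β| - q0 * |v β|) ^ 2 / (4 * r0) := by field_simp; ring
    have : 0 ≤ (2 * r0 * n * |Pm v β| - q0 * |v β|) ^ 2 / (4 * r0) := by positivity
    linarith
  have X3n : 0 ≤ X3 := H3.nonneg (fun β => (sq_nonneg _))
  rw [H3.tsum_eq] at h3
  rw [H7.tsum_eq] at h2
  change X7 ≤ hf α v at h2
  change 1 * Vf (n ^ 2) v ≤ _ at h1
  have a1 := mul_le_mul_of_nonneg_left (h1.trans h4) (by positivity : 0 ≤ q0 * n)
  have a2 := mul_le_mul_of_nonneg_left h2 (by positivity : 0 ≤ r0 * n ^ 2)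
  have a3 := mul_le_mul_of_nonneg_left h3 (by positivity : 0 ≤ q0 ^ 2 / (4 * r0) + q0)
  have a4 : q0 * n * (1 / n ^ 2 * X3) ≤ q0 * X3 := by
    have e : q0 * n * (1 / n ^ 2 * X3) = q0 * X3 * (1 / n) := by field_simp
    rw [e]
    exact mul_le_of_le_one_right (by positivity) (by rw [div_le_one hn0]; exact hn)
  linarith

lemma window {c₀ α n ν q0 r0 s T t0 : ℝ} (hc : 1 < c₀) (hα : c₀ ≤ α) (hn : 1 ≤ n) (hν : ν * n ^ 5 = 1)
    (hq : 0 < q0) (hr : 0 < r0) (hs0 : 0 < s) (hqr : q0 ^ 2 / (4 * r0) + q0 ≤ s * (1 - c₀⁻¹) / 16)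
    (H : ∀ z τ x p ω F : ℝ, 0 < z → 0 ≤ τ → τ ≤ 1 → 0 ≤ ω → ω ≤ 1 → ω ≤ 2 * z → 1 / (1 + z) ^ 2 ≤ F →
      -2 * z * x ^ 2 - ((1 - c₀⁻¹) / 16384) / 4 * q0 * τ ^ 3 * F * (p ^ 2 + x ^ 2 / z) + 11 / 2 * q0 * z * x ^ 2
      + 2 * q0 * τ ^ 3 * z * x * p + 3 * q0 * τ ^ 2 * (ω * x * p + x ^ 2)
      - r0 * τ ^ 6 * (2 * (1 - c₀⁻¹) * z * p ^ 2 + x ^ 2)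
      + 6 * r0 * τ ^ 5 * (p ^ 2 + (3 * (1 - c₀⁻¹)⁻¹) * x ^ 2 / z) ≤ - s * τ ^ 3 * x ^ 2)
    {v : ℝ → ℤ → ℝ} (hv : UD T v) (hs : Sol α ν v) (hT : ν * T ≤ 1 / 2) (ht0 : 0 ≤ t0) (htT : t0 + n ^ 3 ≤ T) :
    (1 + s * (1 - c₀⁻¹) / 8) * ef α (v (t0 + n ^ 3)) ≤ ef α (v t0) := by
  have hn0 : 0 < n := by linarith
  have hN : 1 ≤ n ^ 2 := one_le_pow₀ hn
  have hn3 : 0 < n ^ 3 := by positivity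
  have hν0 : 0 < ν := by
    have : 0 < n ^ 5 := by positivity
    by_contra h
    nlinarith
  have hκ := kap_pos hc
  obtain ⟨ce, de⟩ := ef_deriv hc hα hν0.le hv hs
  obtain ⟨ch, dh⟩ := hf_deriv hc hα hν0.le hv hs
  obtain ⟨cV, dV⟩ := Vf_deriv hc hα hν0.le hv hs hN
  have anti := ef_anti hc hα hν0.le hv hs
  have sub : Set.Icc t0 (t0 + n ^ 3) ⊆ Set.Icc 0 T := Set.Icc_subset_Icc ht0 htT
  have sub' : Set.Ioo t0 (t0 + n ^ 3) ⊆ Set.Ioo 0 T := Set.Ioo_subset_Ioo ht0 htT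
  have mem1 : t0 + n ^ 3 ∈ Set.Icc t0 (t0 + n ^ 3) := ⟨by linarith, le_rfl⟩
  have mem0 : t0 ∈ Set.Icc t0 (t0 + n ^ 3) := ⟨le_rfl, by linarith⟩
  set e1 := ef α (v (t0 + n ^ 3)) with he1
  let τ : ℝ → ℝ := fun t => (t - t0) / n ^ 3
  have dτ : ∀ t, HasDerivAt τ (1 / n ^ 3) t := fun t => ((hasDerivAt_id t).sub_const t0).div_const _
  have cτ : ContinuousOn τ (Set.Icc t0 (t0 + n ^ 3)) := fun t _ => (dτ t).continuousAt.continuousWithinAt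
  let Φ : ℝ → ℝ := fun t => ef α (v t) - q0 * n * τ t ^ 3 * Vf (n ^ 2) (v t) + r0 * n ^ 2 * τ t ^ 6 * hf α (v t)
    + s * (1 - c₀⁻¹) / 4 * e1 * τ t ^ 4
  have hΦ : AntitoneOn Φ (Set.Icc t0 (t0 + n ^ 3)) := by
    have dΦ : ∀ t ∈ Set.Ioo t0 (t0 + n ^ 3), ∃ d ≤ 0, HasDerivAt Φ d t := fun t ht => by
      have htI := sub (Set.Ioo_subset_Icc_self ht)
      have hτ0 : 0 ≤ τ t := div_nonneg (by linarith [ht.1]) hn3.le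
      have hτ1 : τ t ≤ 1 := by
        change (t - t0) / n ^ 3 ≤ 1
        rw [div_le_one hn3]; linarith [ht.2]
      have D := (((de t (sub' ht)).sub ((((dτ t).pow 3).const_mul (q0 * n)).mul (dV t (sub' ht)))).add
        ((((dτ t).pow 6).const_mul (r0 * n ^ 2)).mul (dh t (sub' ht)))).add
        (((dτ t).pow 4).const_mul (s * (1 - c₀⁻¹) / 4 * e1))
      refine ⟨_, ?_, D⟩
      have hw1 : Real.exp (-(ν * t)) ≤ 1 := Real.exp_le_one_iff.mpr (by
        have := mul_nonneg hν0.le htI.1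
        linarith)
      have hw : 1 / 2 ≤ Real.exp (-(ν * t)) := by
        have := Real.add_one_le_exp (-(ν * t))
        have := mul_le_mul_of_nonneg_left htI.2 hν0.le
        linarith
      have L := lyap hc hα hn hν hw hw1 hτ0 hτ1 hq hr H (hv.rd htI)
      change _ - _ - 3 * q0 * τ t ^ 2 / n ^ 2 * Vf (n ^ 2) (v t) + _ + 6 * r0 * τ t ^ 5 / n * hf α (v t) ≤ _ at L
      have b1 := ef_upper hc hα (hv.rd htI)
      have b2 : e1 ≤ ef α (v t) := anti htI (sub mem1) ht.2.le
      have b3 := (mul_le_mul_of_nonneg_left b2 hκ.le).trans b1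
      have b4 := mul_le_mul_of_nonneg_left b3 (by positivity : 0 ≤ s * τ t ^ 3 / n ^ 3)
      generalize (∑' β, 2 * (v t β * dv α ν (α * Real.exp (-(ν * t))) (v t) β) * (Av α β)⁻¹) = Y1 at *
      generalize (∑' β, fv (n ^ 2) β * (dv α ν (α * Real.exp (-(ν * t))) (v t) β * v t (β + 1) + v t β * dv α ν (α * Real.exp (-(ν * t))) (v t) (β + 1))) = Y2 at *
      generalize (∑' β, (2 * (v t β * dv α ν (α * Real.exp (-(ν * t))) (v t) β) * (Av α β)⁻¹
          - Av α β * (2 * (Cm (v t) β * Cm (dv α ν (α * Real.exp (-(ν * t))) (v t)) β)))) = Y4 at *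
      generalize hf α (v t) = Y5 at *
      generalize Vf (n ^ 2) (v t) = Y3 at *
      generalize (∑' β, v t β ^ 2) = Y6 at *
      simp only [Pi.pow_apply]
      clear D
      generalize τ t = x at *
      refine le_trans (le_of_eq ?_) (by linarith : (Y1 - q0 * n * x ^ 3 * Y2 - 3 * q0 * x ^ 2 / n ^ 2 * Y3
        + r0 * n ^ 2 * x ^ 6 * Y4 + 6 * r0 * x ^ 5 / n * Y5 - - s * x ^ 3 / n ^ 3 * Y6)
        + (s * x ^ 3 / n ^ 3 * ((1 - c₀⁻¹) * e1) - s * x ^ 3 / n ^ 3 * Y6) ≤ 0)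
      push_cast
      field_simp
      ring
    apply antitoneOn_of_deriv_nonpos (convex_Icc _ _)
    · exact (((ce.mono sub).sub (((cτ.pow 3).const_smul (q0 * n)).mul (cV.mono sub))).add
        ((((cτ.pow 6).const_smul (r0 * n ^ 2)).mul (ch.mono sub)))).add
        ((cτ.pow 4).const_smul (s * (1 - c₀⁻¹) / 4 * e1))
    · rw [interior_Icc]
      intro t ht
      obtain ⟨d, _, h⟩ := dΦ t ht
      exact h.differentiableAt.differentiableWithinAt
    · rw [interior_Icc]
      intro t ht
      obtain ⟨d, hd, h⟩ := dΦ t ht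
      rw [h.deriv]; exact hd
  have fin := hΦ mem0 mem1 (by linarith)
  have z0 : τ t0 = 0 := by simp [τ]
  have z1 : τ (t0 + n ^ 3) = 1 := by simp [τ, hn0.ne']
  simp only [Φ, z0, z1] at fin
  have eb := end_bound hc hα hn hq hr (hv.rd (sub mem1))
  have e1n : 0 ≤ e1 := tsum_nonneg (fun β => mul_nonneg (sq_nonneg _) (inv_pos.mpr (Av_pos hc hα β)).le)
  have := mul_le_mul_of_nonneg_right hqr e1n
  have := mul_nonneg (mul_nonneg hs0.le hκ.le) e1n
  rw [← he1] at fin eb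
  norm_num at fin
  linarith


lemma ef_nonneg {c₀ α : ℝ} (hc : 1 < c₀) (hα : c₀ ≤ α) (v : ℤ → ℝ) : 0 ≤ ef α v :=
  tsum_nonneg (fun β => mul_nonneg (sq_nonneg _) (inv_pos.mpr (Av_pos hc hα β)).le)

lemma decay {c₀ : ℝ} (hc : 1 < c₀) : ∃ δ : ℝ, 0 < δ ∧ ∀ (α n ν T : ℝ) (v : ℝ → ℤ → ℝ), c₀ ≤ α → 1 ≤ n →
    ν * n ^ 5 = 1 → UD T v → Sol α ν v → ν * T ≤ 1 / 2 → ∀ t, 0 ≤ t → t ≤ T →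
    ef α (v t) ≤ (1 + δ) * Real.exp (- Real.log (1 + δ) * (t / n ^ 3)) * ef α (v 0) := by
  have hκ := kap_pos hc
  have hκ1 := (kap_lt hc).le
  have hCh : 1 ≤ 3 * (1 - c₀⁻¹)⁻¹ := by
    have := (one_le_inv₀ hκ).mpr hκ1
    linarith
  obtain ⟨q0, r0, s, hq, hr, hs0, hqr, H⟩ := consts hκ hκ1 (c := (1 - c₀⁻¹) / 16384) (by positivity) (by linarith) hCh
  refine ⟨s * (1 - c₀⁻¹) / 8, by positivity, ?_⟩
  intro α n ν T v hα hn hν hv hs hT t ht htT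
  set δ := s * (1 - c₀⁻¹) / 8 with hδ
  have hδ0 : 0 < δ := by positivity
  have hn3 : 0 < n ^ 3 := by positivity
  have hν0 : 0 < ν := by
    have : 0 < n ^ 5 := by positivity
    by_contra h
    nlinarith
  have ind : ∀ k : ℕ, (k : ℝ) * n ^ 3 ≤ T → (1 + δ) ^ k * ef α (v (k * n ^ 3)) ≤ ef α (v 0) := by
    intro k
    induction k with
    | zero => intro _; simp
    | succ k ih =>
      intro hk
      push_cast at hk ⊢
      have hk' : (k : ℝ) * n ^ 3 + n ^ 3 ≤ T := by linarith
      have w := window hc hα hn hν hq hr hs0 hqr H hv hs hT (t0 := (k : ℝ) * n ^ 3) (by positivity) hk'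
      rw [← hδ] at w
      have e : ((k : ℝ) + 1) * n ^ 3 = (k : ℝ) * n ^ 3 + n ^ 3 := by ring
      rw [e, pow_succ, mul_assoc]
      exact (mul_le_mul_of_nonneg_left w (by positivity)).trans (ih (by linarith))
  have hx : 0 ≤ t / n ^ 3 := by positivity
  obtain ⟨k, hk⟩ : ∃ k, k = ⌊t / n ^ 3⌋₊ := ⟨_, rfl⟩
  have k1 : (k : ℝ) ≤ t / n ^ 3 := by rw [hk]; exact Nat.floor_le hx
  have k2 : t / n ^ 3 < k + 1 := by rw [hk]; exact Nat.lt_floor_add_one _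
  have k3 : (k : ℝ) * n ^ 3 ≤ t := by rwa [le_div_iff₀ hn3] at k1
  have a1 := ind k (k3.trans htT)
  have a2 : ef α (v t) ≤ ef α (v (k * n ^ 3)) :=
    ef_anti hc hα hν0.le hv hs ⟨by positivity, k3.trans htT⟩ ⟨ht, htT⟩ k3
  have a3 : Real.exp (Real.log (1 + δ) * (t / n ^ 3)) ≤ (1 + δ) ^ (k + 1) := by
    have hl : 0 < Real.log (1 + δ) := Real.log_pos (by linarith)
    calc Real.exp (Real.log (1 + δ) * (t / n ^ 3)) ≤ Real.exp (((k + 1 : ℕ) : ℝ) * Real.log (1 + δ)) := by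
          apply Real.exp_le_exp.mpr
          push_cast
          nlinarith
      _ = (1 + δ) ^ (k + 1) := by rw [Real.exp_nat_mul, Real.exp_log (by linarith)]
  have e0 := ef_nonneg hc hα (v 0)
  have et := ef_nonneg hc hα (v t)
  have a4 : Real.exp (Real.log (1 + δ) * (t / n ^ 3)) * ef α (v t) ≤ (1 + δ) * ef α (v 0) := by
    calc _ ≤ (1 + δ) ^ (k + 1) * ef α (v t) := mul_le_mul_of_nonneg_right a3 et
      _ = (1 + δ) * ((1 + δ) ^ k * ef α (v t)) := by ring
      _ ≤ (1 + δ) * ef α (v 0) := by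
        apply mul_le_mul_of_nonneg_left _ (by linarith)
        exact (mul_le_mul_of_nonneg_left a2 (by positivity)).trans a1
  rw [neg_mul, Real.exp_neg]
  have := Real.exp_pos (Real.log (1 + δ) * (t / n ^ 3))
  rw [mul_right_comm, ← div_eq_mul_inv, le_div_iff₀ this]
  linarith

lemma dom_theta {θ : ℝ → ℤ → ℂ} (h : RapidlyDecaying θ) {T : ℝ} (hT : 0 < T) :
    ∃ V : ℤ → ℝ, RD V ∧ ∀ t ∈ Set.Icc 0 T, ∀ β, ‖θ t β‖ ≤ V β := by
  have key : ∀ k : ℕ, ∃ C : ℝ, 0 ≤ C ∧ ∀ t ∈ Set.Icc 0 T, ∀ β : ℤ, (1 + (β : ℝ) ^ 2) ^ k * ‖θ t β‖ ≤ C := by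
    intro k
    obtain ⟨M, hM⟩ := h (2 * k) T hT
    refine ⟨Real.sqrt M, Real.sqrt_nonneg _, fun t ht β => ?_⟩
    obtain ⟨h1, h2⟩ := hM t ht.1 ht.2
    have := h1.le_tsum β (fun j _ => by positivity)
    apply Real.le_sqrt_of_sq_le
    refine le_trans (le_of_eq ?_) (this.trans h2)
    ring
  have hne : Nonempty (Set.Icc 0 T) := ⟨⟨0, le_rfl, hT.le⟩⟩
  refine ⟨fun β => ⨆ t : Set.Icc 0 T, ‖θ t β‖, ?_, ?_⟩
  · intro k
    obtain ⟨C, hC0, hC⟩ := key k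
    refine ⟨C, fun β => ?_⟩
    have hw : (0 : ℝ) < (1 + (β : ℝ) ^ 2) ^ k := by positivity
    have h0 : 0 ≤ ⨆ t : Set.Icc 0 T, ‖θ t β‖ := Real.iSup_nonneg (fun _ => norm_nonneg _)
    rw [abs_of_nonneg h0, mul_comm, ← le_div_iff₀ hw]
    apply ciSup_le
    intro t
    rw [le_div_iff₀ hw, mul_comm]
    exact hC t t.2 β
  · intro t ht β
    obtain ⟨C, hC0, hC⟩ := key 0
    have hb : BddAbove (Set.range (fun t : Set.Icc 0 T => ‖θ t β‖)) := ⟨C, by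
      rintro _ ⟨s, rfl⟩
      simpa using hC s s.2 β⟩
    exact le_ciSup hb ⟨t, ht⟩

noncomputable def gv (α σ : ℝ) (μ : ℂ) (θ : ℝ → ℤ → ℂ) (t : ℝ) (β : ℤ) : ℝ :=
  Av α β * (μ * ((σ : ℂ) * Complex.I) ^ β * θ t β).re

lemma Sv_sgn {α σ : ℝ} (hσ : σ ^ 2 = 1) (β : ℤ) : Sv (σ * α) β = Sv α β := by
  unfold Sv; rw [mul_pow, hσ, one_mul]

lemma zeta_ne {σ : ℝ} (hσ : σ ^ 2 = 1) : (σ : ℂ) * Complex.I ≠ 0 := by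
  apply mul_ne_zero _ Complex.I_ne_zero
  intro h
  have : σ = 0 := by exact_mod_cast h
  rw [this] at hσ; norm_num at hσ

lemma gv_sol {α σ ν : ℝ} (hσ : σ ^ 2 = 1) (μ : ℂ) {θ : ℝ → ℤ → ℂ} (h : CriticalQG α ν θ) :
    Sol (σ * α) ν (gv (σ * α) σ μ θ) := by
  intro t β
  have d := (h t β).const_mul (μ * ((σ : ℂ) * Complex.I) ^ β)
  have d2 := (Complex.reCLM.hasFDerivAt.comp_hasDerivAt t d).const_mul (Av (σ * α) β)
  refine d2.congr_deriv ?_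
  have hz := zeta_ne hσ
  have hσc : (σ : ℂ) ^ 2 = 1 := by exact_mod_cast hσ
  have hinv : ((σ : ℂ) * Complex.I)⁻¹ = -((σ : ℂ) * Complex.I) := by
    apply inv_eq_of_mul_eq_one_right
    linear_combination hσc * 1 - (σ : ℂ) ^ 2 * Complex.I_sq
  have key : μ * ((σ : ℂ) * Complex.I) ^ β * (-((ν * Sv α β : ℝ) : ℂ) * θ t β
        - Complex.I * (α : ℂ) * ((Real.exp (-(ν * t)) : ℝ) : ℂ) / 2 *
          ((1 - ((Sv α (β - 1) : ℝ) : ℂ)⁻¹) * θ t (β - 1)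
            + (1 - ((Sv α (β + 1) : ℝ) : ℂ)⁻¹) * θ t (β + 1)))
      = ((-ν * Sv α β : ℝ) : ℂ) * (μ * ((σ : ℂ) * Complex.I) ^ β * θ t β)
        + ((σ * α * Real.exp (-(ν * t)) / 2 * (1 - (Sv α (β - 1))⁻¹) : ℝ) : ℂ) * (μ * ((σ : ℂ) * Complex.I) ^ (β - 1) * θ t (β - 1))
        + ((-(σ * α * Real.exp (-(ν * t)) / 2 * (1 - (Sv α (β + 1))⁻¹)) : ℝ) : ℂ) * (μ * ((σ : ℂ) * Complex.I) ^ (β + 1) * θ t (β + 1)) := by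
    rw [zpow_sub_one₀ hz, zpow_add_one₀ hz, hinv]
    push_cast
    generalize ((σ : ℂ) * Complex.I) ^ β = P
    linear_combination (Complex.I * (α : ℂ) * Complex.exp (-(ν * t)) / 2 * μ * P *
      ((1 - ((Sv α (β - 1) : ℝ) : ℂ)⁻¹) * θ t (β - 1) + (1 - ((Sv α (β + 1) : ℝ) : ℂ)⁻¹) * θ t (β + 1))) * hσc
  rw [key]
  simp only [Complex.reCLM_apply, Complex.add_re, Complex.re_ofReal_mul]
  simp only [dv, Cm, gv, Av, Sv_sgn hσ]
  ring

lemma norm_zeta {σ : ℝ} (hσ : σ ^ 2 = 1) (β : ℤ) : ‖((σ : ℂ) * Complex.I) ^ β‖ = 1 := by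
  have : |σ| = 1 := by
    rw [← sq_eq_sq₀ (abs_nonneg _) zero_le_one, sq_abs, hσ]; norm_num
  rw [norm_zpow, norm_mul, Complex.norm_I, Complex.norm_real, Real.norm_eq_abs, this]
  simp

lemma gv_UD {c₀ α σ T : ℝ} (hc : 1 < c₀) (hα : c₀ ≤ α) (hσ : σ ^ 2 = 1) {μ : ℂ} (hμ : ‖μ‖ = 1)
    {θ : ℝ → ℤ → ℂ} (h : RapidlyDecaying θ) (hT : 0 < T) : UD T (gv α σ μ θ) := by
  obtain ⟨V, hV, hb⟩ := dom_theta h hT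
  refine ⟨V, hV, fun t ht β => ?_⟩
  have h1 := Complex.abs_re_le_norm (μ * ((σ : ℂ) * Complex.I) ^ β * θ t β)
  rw [norm_mul, norm_mul, hμ, norm_zeta hσ, one_mul, one_mul] at h1
  unfold gv
  rw [abs_mul, abs_of_pos (Av_pos hc hα β)]
  have h2 := mul_le_mul (Av_le hc hα β) (h1.trans (hb t ht β)) (abs_nonneg _) zero_le_one
  linarith

lemma gv_pair {c₀ α σ T : ℝ} (hc : 1 < c₀) (hα : c₀ ≤ α) (hσ : σ ^ 2 = 1)
    {θ : ℝ → ℤ → ℂ} (h : RapidlyDecaying θ) (hT : 0 < T) {t : ℝ} (ht : t ∈ Set.Icc 0 T) :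
    (1 - c₀⁻¹) * (∑' β, ‖θ t β‖ ^ 2) ≤ ef α (gv α σ 1 θ t) + ef α (gv α σ (-Complex.I) θ t) ∧
    ef α (gv α σ 1 θ t) + ef α (gv α σ (-Complex.I) θ t) ≤ ∑' β, ‖θ t β‖ ^ 2 := by
  have r1 := (gv_UD hc hα hσ (μ := 1) (by simp) h hT).rd ht
  have r2 := (gv_UD hc hα hσ (μ := -Complex.I) (by simp) h hT).rd ht
  have hsum : Summable (fun β => ‖θ t β‖ ^ 2) := by
    obtain ⟨M, hM⟩ := h 0 T hT
    simpa using (hM t ht.1 ht.2).1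
  have S := (r1.pow.mul_pb (PB_Ainv hc hα)).summable.hasSum.add (r2.pow.mul_pb (PB_Ainv hc hα)).summable.hasSum
  have e : ∀ β, gv α σ 1 θ t β ^ 2 * (Av α β)⁻¹ + gv α σ (-Complex.I) θ t β ^ 2 * (Av α β)⁻¹
      = Av α β * ‖θ t β‖ ^ 2 := fun β => by
    have hA := (Av_pos hc hα β).ne'
    have hn : ‖θ t β‖ ^ 2 = (((σ : ℂ) * Complex.I) ^ β * θ t β).re ^ 2 + (((σ : ℂ) * Complex.I) ^ β * θ t β).im ^ 2 := by
      have : ‖θ t β‖ = ‖((σ : ℂ) * Complex.I) ^ β * θ t β‖ := by rw [norm_mul, norm_zeta hσ, one_mul]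
      rw [this, Complex.sq_norm, Complex.normSq_apply]; ring
    have hI : (-Complex.I * ((σ : ℂ) * Complex.I) ^ β * θ t β).re = (((σ : ℂ) * Complex.I) ^ β * θ t β).im := by
      rw [mul_assoc]; simp only [Complex.mul_re, Complex.neg_re, Complex.neg_im, Complex.I_re, Complex.I_im]; ring
    unfold gv
    rw [hn, hI, one_mul]
    field_simp
  constructor
  · refine hasSum_le (fun β => ?_) (hsum.hasSum.mul_left _) S
    rw [e]
    exact mul_le_mul_of_nonneg_right (Av_ge hc hα β) (sq_nonneg _)
  · refine hasSum_le (fun β => ?_) S hsum.hasSum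
    rw [e]
    exact mul_le_of_le_one_left (sq_nonneg _) (Av_le hc hα β)

theorem critical_QG_enhanced_dissipation (c₀ : ℝ) (hc₀ : 1 < c₀) :
    ∃ ν₀ c C : ℝ, 0 < ν₀ ∧ ν₀ ≤ 1 ∧ 0 < c ∧ 1 < C ∧
      ∀ ν : ℝ, 0 < ν → ν < ν₀ → ∀ α : ℝ, c₀ ≤ |α| →
      ∀ θ : ℝ → ℤ → ℂ, RapidlyDecaying θ → CriticalQG α ν θ →
      ∀ t : ℝ, 0 ≤ t → t ≤ C⁻¹ * ν⁻¹ →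
        (∑' β : ℤ, ‖θ t β‖ ^ 2) ≤
          C ^ 2 * Real.exp (-2 * c * ν ^ ((3 : ℝ) / 5) * t) * ∑' β : ℤ, ‖θ 0 β‖ ^ 2 := by
  obtain ⟨δ, hδ, D⟩ := decay hc₀
  have hκ := kap_pos hc₀
  have hl : 0 < Real.log (1 + δ) := Real.log_pos (by linarith)
  have hK : 0 < (1 + δ) / (1 - c₀⁻¹) := by positivity
  set K := (1 + δ) / (1 - c₀⁻¹) with hKd
  refine ⟨1, Real.log (1 + δ) / 2, 2 + K, one_pos, le_rfl, by positivity, by linarith, ?_⟩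
  intro ν hν hν1 α hα θ hR hQ t ht htT
  obtain ⟨σ, hσ, hσα⟩ : ∃ σ : ℝ, σ ^ 2 = 1 ∧ σ * α = |α| := by
    rcases le_total 0 α with h | h
    · exact ⟨1, by norm_num, by rw [abs_of_nonneg h, one_mul]⟩
    · exact ⟨-1, by norm_num, by rw [abs_of_nonpos h]; ring⟩
  have hα' : c₀ ≤ σ * α := by rw [hσα]; exact hα
  set T := (2 + K)⁻¹ * ν⁻¹ with hTd
  have hT : 0 < T := by positivity
  have hνT : ν * T ≤ 1 / 2 := by
    have : ν * T = (2 + K)⁻¹ := by rw [hTd]; field_simp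
    rw [this, one_div]
    exact inv_anti₀ (by norm_num) (by linarith)
  have hn : 1 ≤ ν ^ (-(1 : ℝ) / 5) := Real.one_le_rpow_of_pos_of_le_one_of_nonpos hν hν1.le (by norm_num)
  have hn5 : ν * (ν ^ (-(1 : ℝ) / 5)) ^ 5 = 1 := by
    rw [← Real.rpow_natCast, ← Real.rpow_mul hν.le]
    norm_num
    rw [Real.rpow_neg_one]; field_simp
  have hn3 : t / (ν ^ (-(1 : ℝ) / 5)) ^ 3 = ν ^ ((3 : ℝ) / 5) * t := by
    rw [← Real.rpow_natCast, ← Real.rpow_mul hν.le, div_eq_mul_inv, ← Real.rpow_neg hν.le, mul_comm]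
    norm_num
  have d1 := D (σ * α) _ ν T _ hα' hn hn5 (gv_UD hc₀ hα' hσ (μ := 1) (by simp) hR hT) (gv_sol hσ 1 hQ) hνT t ht htT
  have d2 := D (σ * α) _ ν T _ hα' hn hn5 (gv_UD hc₀ hα' hσ (μ := -Complex.I) (by simp) hR hT)
    (gv_sol hσ (-Complex.I) hQ) hνT t ht htT
  rw [hn3] at d1 d2
  have p1 := (gv_pair hc₀ hα' hσ hR hT ⟨ht, htT⟩).1
  have p2 := (gv_pair hc₀ hα' hσ hR hT (t := 0) ⟨le_rfl, hT.le⟩).2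
  have e : -2 * (Real.log (1 + δ) / 2) * ν ^ ((3 : ℝ) / 5) * t = - Real.log (1 + δ) * (ν ^ ((3 : ℝ) / 5) * t) := by ring
  rw [e]
  set E := Real.exp (- Real.log (1 + δ) * (ν ^ ((3 : ℝ) / 5) * t)) with hE
  have hE0 : 0 < E := Real.exp_pos _
  have X0 : 0 ≤ ∑' β : ℤ, ‖θ 0 β‖ ^ 2 := tsum_nonneg (fun _ => sq_nonneg _)
  generalize (∑' β : ℤ, ‖θ 0 β‖ ^ 2) = X at *
  generalize (∑' β : ℤ, ‖θ t β‖ ^ 2) = Y at *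
  have f1 : (1 - c₀⁻¹) * Y ≤ (1 + δ) * E * X := by
    have := mul_le_mul_of_nonneg_left p2 (by positivity : 0 ≤ (1 + δ) * E)
    linarith
  have f2 : Y ≤ K * E * X := by
    have : Y ≤ (1 + δ) * E * X / (1 - c₀⁻¹) := by rw [le_div_iff₀ hκ]; linarith
    refine this.trans (le_of_eq ?_)
    rw [hKd]; ring
  refine f2.trans ?_
  have : K ≤ (2 + K) ^ 2 := by nlinarith
  gcongr
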